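/- Every closed (compact without boundary) smooth Levi-flat real hypersurface in CP^n with n > 2 is simply connected. -/

import Mathlib

/- STATEMENT 16: Every closed (compact without boundary) smooth Levi-flat real
hypersurface in ℂℙⁿ with n > 2 is simply connected.

Here ℂℙⁿ is realized as the projectivization `ℙ ℂ (ℂ^{n+1})` with the quotient topology,
so that "simply connected" refers to the actual topology of M.  The hypersurface and
Levi-flatness conditions are imposed on the cone over M in ℂ^{n+1} ∖ {0}. -/

open Complex Set

noncomputable section

/-- The Levi form (up to a positive factor) of the defining function `ρ` at `p`,
evaluated at `w`: `D²ρ(p)(w,w) + D²ρ(p)(Jw,Jw) = 4 ∑ ∂²ρ/∂zⱼ∂z̄ₖ wⱼ w̄ₖ`. -/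
def leviForm {m : ℕ} (ρ : (Fin m → ℂ) → ℝ) (p w : Fin m → ℂ) : ℝ :=
  iteratedFDeriv ℝ 2 ρ p ![w, w] + iteratedFDeriv ℝ 2 ρ p ![Complex.I • w, Complex.I • w]

/-- `w` belongs to the complex tangent space at `p` of the hypersurface `{ρ = 0}`. -/
def IsComplexTangent {m : ℕ} (ρ : (Fin m → ℂ) → ℝ) (p w : Fin m → ℂ) : Prop :=
  fderiv ℝ ρ p w = 0 ∧ fderiv ℝ ρ p (Complex.I • w) = 0

/-- `M` is a smooth (`C^∞`) Levi-flat real hypersurface: near each of its points it is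
the zero set of a smooth defining function with nonvanishing gradient whose Levi form
vanishes identically on complex tangent vectors. -/
def IsSmoothLeviFlatHypersurface {m : ℕ} (M : Set (Fin m → ℂ)) : Prop :=
  ∀ p ∈ M, ∃ V : Set (Fin m → ℂ), IsOpen V ∧ p ∈ V ∧ ∃ ρ : (Fin m → ℂ) → ℝ,
    (∀ k : ℕ, ContDiffOn ℝ k ρ V) ∧ (∀ q ∈ V, fderiv ℝ ρ q ≠ 0) ∧
    (∀ q ∈ V, q ∈ M ↔ ρ q = 0) ∧
    (∀ q ∈ V, ρ q = 0 → ∀ w, IsComplexTangent ρ q w → leviForm ρ q w = 0)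

open scoped LinearAlgebra.Projectivization

/-- The quotient topology on the projectivization. -/
instance {n : ℕ} : TopologicalSpace (ℙ ℂ (Fin n → ℂ)) :=
  inferInstanceAs (TopologicalSpace (Quotient _))

/-- The cone in `ℂ^{n+1} ∖ {0}` over a subset of `ℂℙⁿ`. -/
def coneOver {n : ℕ} (S : Set (ℙ ℂ (Fin (n + 1) → ℂ))) : Set (Fin (n + 1) → ℂ) :=
  {v | ∃ h : v ≠ 0, Projectivization.mk ℂ v h ∈ S}

section Taylor

open scoped Topology
open Filter

/-- The second order Taylor expansion of a `C²` function. -/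
theorem isLittleO_taylor_two {E : Type*} [NormedAddCommGroup E] [NormedSpace ℝ E]
    {f : E → ℝ} {p : E} (hf : ContDiffAt ℝ 2 f p) :
    (fun h => f (p + h) - f p - fderiv ℝ f p h - (1 / 2) * fderiv ℝ (fderiv ℝ f) p h h)
      =o[𝓝 0] (fun h => ‖h‖ ^ 2) := by
  set A := fderiv ℝ (fderiv ℝ f) p with hA
  have hsymm : ∀ x y, A x y = A y x := by
    have := hf.isSymmSndFDerivAt (by simp)
    intro x y
    exact this x y
  have h1 : ContDiffAt ℝ 1 (fderiv ℝ f) p := hf.fderiv_right (by norm_num)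
  have h2 : HasFDerivAt (fderiv ℝ f) A p := (h1.differentiableAt (by norm_num)).hasFDerivAt
  have h3 : ∀ᶠ x in 𝓝 p, DifferentiableAt ℝ f x := by
    filter_upwards [hf.eventually (by simp)] with x hx
    exact hx.differentiableAt (by norm_num)
  rw [Asymptotics.isLittleO_iff]
  intro c hc
  have h4 := (hasFDerivAt_iff_isLittleO_nhds_zero.1 h2).def hc
  have h5 : ∀ᶠ h in 𝓝 (0 : E), DifferentiableAt ℝ f (p + h) := by
    have : Tendsto (fun h : E => p + h) (𝓝 0) (𝓝 p) := by
      have : Continuous (fun h : E => p + h) := by fun_prop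
      simpa using this.tendsto 0
    exact this.eventually h3
  obtain ⟨r, hr, hball⟩ := Metric.eventually_nhds_iff_ball.1 (h4.and h5)
  filter_upwards [Metric.ball_mem_nhds (0 : E) hr] with h hh
  have hsub : Metric.closedBall (0 : E) ‖h‖ ⊆ Metric.ball 0 r := by
    intro x hx
    simp only [Metric.mem_closedBall, Metric.mem_ball, dist_zero_right] at *
    linarith
  have hd : ∀ x ∈ Metric.closedBall (0 : E) ‖h‖, HasFDerivWithinAt
      (fun h => f (p + h) - f p - fderiv ℝ f p h - (1 / 2) * A h h)
      (fderiv ℝ f (p + x) - fderiv ℝ f p - A x) (Metric.closedBall (0 : E) ‖h‖) x := by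
    intro x hx
    have e1 : HasFDerivAt (fun h => f (p + h)) (fderiv ℝ f (p + x)) x := by
      have := (hball x (hsub hx)).2.hasFDerivAt.comp x ((hasFDerivAt_id x).const_add p)
      exact this
    have e2 : HasFDerivAt (fun h => A h h) (A x + A.flip x) x := by
      have := (A.hasFDerivAt (x := x)).clm_apply (hasFDerivAt_id x)
      refine this.congr_fderiv ?_
      ext y
      simp
    have e3 := ((e1.sub_const (f p)).sub (fderiv ℝ f p).hasFDerivAt).sub (e2.const_mul (1 / 2))
    refine (e3.congr_fderiv ?_).hasFDerivWithinAt
    ext y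
    simp [hsymm y x]
    ring
  have hb : ∀ x ∈ Metric.closedBall (0 : E) ‖h‖,
      ‖fderiv ℝ f (p + x) - fderiv ℝ f p - A x‖ ≤ c * ‖h‖ := by
    intro x hx
    refine ((hball x (hsub hx)).1).trans ?_
    gcongr
    simpa using hx
  have := (convex_closedBall (0 : E) ‖h‖).norm_image_sub_le_of_norm_hasFDerivWithin_le hd hb
    (x := 0) (y := h) (by simp) (by simp)
  simp only [add_zero, sub_self, map_zero, mul_zero, sub_zero] at this
  rw [norm_pow, norm_norm, sq]
  calc _ ≤ _ := this
    _ = _ := by ring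

/-- Second order behaviour of `f` along a curve `t ↦ p + t • a + t² • b + o(t²)`. -/
theorem tendsto_second_order_curve {E : Type*} [NormedAddCommGroup E] [NormedSpace ℝ E]
    {f : E → ℝ} {p a b : E} (hf : ContDiffAt ℝ 2 f p) {γ : ℝ → E}
    (hγ : Tendsto (fun t : ℝ => (t ^ 2)⁻¹ • (γ t - t • a)) (𝓝[>] 0) (𝓝 b))
    (h0 : fderiv ℝ f p a = 0) :
    Tendsto (fun t => (f (p + γ t) - f p) / t ^ 2) (𝓝[>] 0)
      (𝓝 (fderiv ℝ f p b + (1 / 2) * fderiv ℝ (fderiv ℝ f) p a a)) := by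
  set A := fderiv ℝ (fderiv ℝ f) p with hA
  set ℓ := fderiv ℝ f p with hℓ
  have hto : Tendsto (fun t : ℝ => t) (𝓝[>] 0) (𝓝 0) := nhdsWithin_le_nhds
  have hpos : ∀ᶠ t : ℝ in 𝓝[>] 0, 0 < t := eventually_mem_nhdsWithin
  have h1 : Tendsto (fun t : ℝ => t⁻¹ • γ t) (𝓝[>] 0) (𝓝 a) := by
    have : Tendsto (fun t : ℝ => t • ((t ^ 2)⁻¹ • (γ t - t • a)) + a) (𝓝[>] 0)
        (𝓝 ((0 : ℝ) • b + a)) := (hto.smul hγ).add_const a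
    rw [zero_smul, zero_add] at this
    refine this.congr' ?_
    filter_upwards [hpos] with t ht
    have e1 : t * (t ^ 2)⁻¹ = t⁻¹ := by field_simp
    rw [smul_smul, e1, smul_sub, smul_smul, inv_mul_cancel₀ ht.ne', one_smul, sub_add_cancel]
  have h2 : Tendsto γ (𝓝[>] 0) (𝓝 0) := by
    have := hto.smul h1
    rw [zero_smul] at this
    refine this.congr' ?_
    filter_upwards [hpos] with t ht
    rw [smul_smul, mul_inv_cancel₀ ht.ne', one_smul]
  have h3 := (isLittleO_taylor_two hf).comp_tendsto h2
  have h4 : (fun t => ‖γ t‖ ^ 2) =O[𝓝[>] 0] (fun t : ℝ => t ^ 2) := by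
    have h5 : Tendsto (fun t : ℝ => ‖γ t‖ ^ 2 / t ^ 2) (𝓝[>] 0) (𝓝 (‖a‖ ^ 2)) := by
      refine (h1.norm.pow 2).congr' ?_
      filter_upwards [hpos] with t ht
      rw [norm_smul, mul_pow, norm_inv, Real.norm_of_nonneg ht.le]
      field_simp
    refine Asymptotics.isBigO_of_div_tendsto_nhds ?_ _ h5
    filter_upwards [hpos] with t ht h
    exact absurd h (by positivity)
  have h6 := (h3.trans_isBigO h4).tendsto_div_nhds_zero
  have h7 : Tendsto (fun t : ℝ => ℓ ((t ^ 2)⁻¹ • (γ t - t • a))) (𝓝[>] 0) (𝓝 (ℓ b)) :=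
    (ℓ.continuous.tendsto b).comp hγ
  have h8 : Tendsto (fun t : ℝ => A (t⁻¹ • γ t) (t⁻¹ • γ t)) (𝓝[>] 0) (𝓝 (A a a)) := by
    have hc : Continuous (fun x => A x x) := by fun_prop
    exact (hc.tendsto a).comp h1
  have h9 := (h6.add h7).add (h8.const_mul (1 / 2))
  rw [zero_add] at h9
  refine h9.congr' ?_
  filter_upwards [hpos] with t ht
  simp only [Function.comp, map_smul, map_sub, h0, smul_eq_mul,
    smul_apply]
  field_simp
  ring

end Taylor

section Cone

set_option linter.unusedSectionVars false
open scoped Topology InnerProductSpace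
open Filter

attribute [local instance] InnerProductSpace.complexToReal

variable {E : Type*} [NormedAddCommGroup E] [InnerProductSpace ℂ E] [FiniteDimensional ℂ E]

/-- `ρ` is a `C²` defining function of `T` on the neighbourhood `V`. -/
structure IsDefiningOn (T V : Set E) (ρ : E → ℝ) : Prop where
  isOpen : IsOpen V
  contDiffOn : ContDiffOn ℝ 2 ρ V
  fderiv_ne_zero : ∀ q ∈ V, fderiv ℝ ρ q ≠ 0
  mem_iff : ∀ q ∈ V, q ∈ T ↔ ρ q = 0

/-- A nonempty `ℂˣ`-invariant Levi-flat hypersurface of `E ∖ {0}` which is closed there. -/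
structure IsLeviFlatCone (T : Set E) : Prop where
  nonempty : T.Nonempty
  zero_notMem : (0 : E) ∉ T
  smul_mem : ∀ c : ℂ, c ≠ 0 → ∀ m ∈ T, c • m ∈ T
  isClosed : IsClosed (insert 0 T)
  exists_defining : ∀ p ∈ T, ∃ V ρ, p ∈ V ∧ IsDefiningOn T V ρ ∧
    ∀ w, fderiv ℝ ρ p w = 0 → fderiv ℝ ρ p (I • w) = 0 →
      fderiv ℝ (fderiv ℝ ρ) p w w + fderiv ℝ (fderiv ℝ ρ) p (I • w) (I • w) = 0

theorem IsDefiningOn.contDiffAt {T V : Set E} {ρ : E → ℝ} (h : IsDefiningOn T V ρ) {p : E}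
    (hp : p ∈ V) : ContDiffAt ℝ 2 ρ p :=
  h.contDiffOn.contDiffAt (h.isOpen.mem_nhds hp)

theorem IsDefiningOn.exists_multiplier {T V : Set E} {ρ : E → ℝ} (h : IsDefiningOn T V ρ) {p : E}
    (hpT : p ∈ T) (hp : p ∈ V) {φ : E → ℝ} {φ' : E →L[ℝ] ℝ} (hφ : HasStrictFDerivAt φ φ' p)
    (hext : ∀ x ∈ T, φ p ≤ φ x) : ∃ μ : ℝ, ∀ x, φ' x = μ * fderiv ℝ ρ p x := by
  have : CompleteSpace E := FiniteDimensional.complete ℂ E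
  have hρ : HasStrictFDerivAt ρ (fderiv ℝ ρ p) p :=
    (h.contDiffAt hp).hasStrictFDerivAt (by norm_num)
  have h0 : ρ p = 0 := (h.mem_iff p hp).1 hpT
  have hmin : IsLocalExtrOn φ {x | ρ x = ρ p} p := by
    left
    have hV : ∀ᶠ x in 𝓝[{x | ρ x = ρ p}] p, x ∈ V :=
      nhdsWithin_le_nhds (h.isOpen.mem_nhds hp)
    filter_upwards [hV, self_mem_nhdsWithin] with x hx hx'
    refine hext x ((h.mem_iff x hx).2 ?_)
    rw [← h0]; exact hx'
  obtain ⟨a, b, hab, he⟩ := hmin.exists_multipliers_of_hasStrictFDerivAt_1d hρ hφ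
  have hb : b ≠ 0 := by
    rintro rfl
    have ha : a ≠ 0 := by
      rintro rfl
      exact hab rfl
    simp only [zero_smul, add_zero, smul_eq_zero] at he
    exact he.elim ha (h.fderiv_ne_zero p hp)
  refine ⟨-(a / b), fun x => ?_⟩
  have := DFunLike.congr_fun he x
  simp at this
  field_simp
  linarith

/-- The distance to the closed cone `T ∪ {0}`. -/
def coneDist (T : Set E) (q : E) : ℝ := Metric.infDist q (insert 0 T)

theorem coneDist_nonneg (T : Set E) (q : E) : 0 ≤ coneDist T q := Metric.infDist_nonneg

theorem continuous_coneDist (T : Set E) : Continuous (coneDist T) :=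
  Metric.continuous_infDist_pt _

theorem coneDist_le_dist {T : Set E} {m : E} (hm : m ∈ T) (q : E) : coneDist T q ≤ ‖q - m‖ := by
  rw [← dist_eq_norm]
  exact Metric.infDist_le_dist_of_mem (mem_insert_of_mem _ hm)

theorem coneDist_le_norm (T : Set E) (q : E) : coneDist T q ≤ ‖q‖ := by
  rw [← dist_zero_right]
  exact Metric.infDist_le_dist_of_mem (mem_insert _ _)

theorem coneDist_le_add (T : Set E) (q h : E) : coneDist T (q + h) ≤ coneDist T q + ‖h‖ := by
  have := Metric.infDist_le_infDist_add_dist (s := insert 0 T) (x := q + h) (y := q)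
  simpa [coneDist, dist_eq_norm] using this

theorem coneDist_sub_le (T : Set E) (q h : E) : coneDist T q - ‖h‖ ≤ coneDist T (q + h) := by
  have := coneDist_le_add T (q + h) (-h)
  simp at this
  linarith

theorem coneDist_eq_zero_of_mem {T : Set E} {m : E} (hm : m ∈ T) : coneDist T m = 0 :=
  Metric.infDist_zero_of_mem (mem_insert_of_mem _ hm)

namespace IsLeviFlatCone

variable {T : Set E}

theorem coneDist_smul (hT : IsLeviFlatCone T) {c : ℂ} (hc : c ≠ 0) (q : E) :
    coneDist T (c • q) = ‖c‖ * coneDist T q := by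
  have key : ∀ (c : ℂ), c ≠ 0 → ∀ q, coneDist T (c • q) ≤ ‖c‖ * coneDist T q := by
    intro c hc q
    have : FiniteDimensional ℝ E := FiniteDimensional.complexToReal E
    have : ProperSpace E := FiniteDimensional.proper ℂ E
    obtain ⟨m, hm, he⟩ := hT.isClosed.exists_infDist_eq_dist (insert_nonempty _ _) q
    have : coneDist T q = ‖q - m‖ := by rw [← dist_eq_norm]; exact he
    rw [this, ← norm_smul, smul_sub, ← dist_eq_norm]
    apply Metric.infDist_le_dist_of_mem
    rcases hm with rfl | hm
    · simp
    · exact mem_insert_of_mem _ (hT.smul_mem c hc m hm)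
  refine le_antisymm (key c hc q) ?_
  have := key c⁻¹ (inv_ne_zero hc) (c • q)
  rw [inv_smul_smul₀ hc, norm_inv] at this
  have hc' : 0 < ‖c‖ := norm_pos_iff.2 hc
  calc ‖c‖ * coneDist T q ≤ ‖c‖ * (‖c‖⁻¹ * coneDist T (c • q)) := by gcongr
    _ = _ := by field_simp

theorem coneDist_lt_norm (hT : IsLeviFlatCone T) {q : E} (hq : q ≠ 0) : coneDist T q < ‖q‖ := by
  have : CompleteSpace E := FiniteDimensional.complete ℂ E
  by_contra! hle
  have horth : ∀ m ∈ T, ⟪m, q⟫_ℂ = 0 := by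
    intro m hm
    by_contra hne
    have hm0 : m ≠ 0 := fun h => hT.zero_notMem (h ▸ hm)
    set c : ℂ := ⟪m, q⟫_ℂ / (‖m‖ : ℂ) ^ 2 with hc
    have hm0' : (‖m‖ : ℂ) ≠ 0 := by simpa using hm0
    have hc0 : c ≠ 0 := div_ne_zero hne (pow_ne_zero _ hm0')
    have h1 := coneDist_le_dist (hT.smul_mem c hc0 m hm) q
    have h2 : ⟪c • m, q - c • m⟫_ℂ = 0 := by
      rw [inner_sub_right, inner_smul_left, inner_smul_left, inner_smul_right,
        inner_self_eq_norm_sq_to_K]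
      have : c * (‖m‖ : ℂ) ^ 2 = ⟪m, q⟫_ℂ := by rw [hc]; field_simp
      rw [← this]
      simp
    have h3 := norm_add_sq_eq_norm_sq_add_norm_sq_of_inner_eq_zero _ _ h2
    rw [add_sub_cancel] at h3
    have h4 : 0 < ‖c • m‖ := norm_pos_iff.2 (smul_ne_zero hc0 hm0)
    nlinarith [norm_nonneg (q - c • m), norm_nonneg q]
  obtain ⟨m, hm⟩ := hT.nonempty
  obtain ⟨V, ρ, hmV, hρ, -⟩ := hT.exists_defining m hm
  have mult : ∀ z : ℂ, ∃ μ : ℝ, ∀ x, ⟪z • q, x⟫_ℝ = μ * fderiv ℝ ρ m x := by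
    intro z
    refine hρ.exists_multiplier hm hmV (φ := fun x => ⟪z • q, x⟫_ℝ) (φ' := innerSL ℝ (z • q))
      (innerSL ℝ (z • q)).hasStrictFDerivAt ?_
    have hz : ∀ x ∈ T, ⟪z • q, x⟫_ℝ = 0 := by
      intro x hx
      rw [real_inner_eq_re_inner ℂ, inner_smul_left, ← inner_conj_symm, horth x hx]
      simp
    intro x hx
    rw [hz x hx, hz m hm]
  obtain ⟨μ, hμ⟩ := mult 1
  obtain ⟨ν, hν⟩ := mult I
  have e1 := hμ q
  have e2 := hν q
  have e3 := hν (I • q)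
  have hq' : 0 < ‖q‖ := norm_pos_iff.2 hq
  rw [one_smul, real_inner_self_eq_norm_sq] at e1
  rw [real_inner_eq_re_inner ℂ, inner_smul_left, inner_self_eq_norm_sq_to_K] at e2
  have e2' : ν * fderiv ℝ ρ m q = 0 := by
    rw [← e2]; simp [← ofReal_pow]
  have hne : fderiv ℝ ρ m q ≠ 0 := by
    intro h
    rw [h, mul_zero] at e1
    exact (pow_pos hq' 2).ne' e1
  have hν0 : ν = 0 := by
    rcases mul_eq_zero.1 e2' with h | h
    · exact h
    · exact absurd h hne
  rw [hν0, zero_mul, real_inner_self_eq_norm_sq, norm_smul] at e3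
  simp at e3
  exact hq e3

theorem exists_nearest (hT : IsLeviFlatCone T) {q : E} (hq : q ≠ 0) :
    ∃ m ∈ T, coneDist T q = ‖q - m‖ := by
  have : ProperSpace E := FiniteDimensional.proper ℂ E
  obtain ⟨m, hm, he⟩ := hT.isClosed.exists_infDist_eq_dist (insert_nonempty _ _) q
  have he' : coneDist T q = ‖q - m‖ := by rw [← dist_eq_norm]; exact he
  rcases hm with rfl | hm
  · rw [sub_zero] at he'
    exact absurd he' (hT.coneDist_lt_norm hq).ne
  · exact ⟨m, hm, he'⟩

theorem mem_of_coneDist_eq_zero (hT : IsLeviFlatCone T) {q : E} (hq : q ≠ 0)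
    (h : coneDist T q = 0) : q ∈ T := by
  obtain ⟨m, hm, he⟩ := hT.exists_nearest hq
  rw [h, eq_comm, norm_eq_zero, sub_eq_zero] at he
  exact he ▸ hm

theorem _root_.IsDefiningOn.exists_multiplier_nearest {V : Set E} {ρ : E → ℝ}
    (h : IsDefiningOn T V ρ) {q m : E} (hmT : m ∈ T) (hmV : m ∈ V)
    (hm : coneDist T q = ‖q - m‖) : ∃ μ : ℝ, ∀ x, ⟪q - m, x⟫_ℝ = μ * fderiv ℝ ρ m x := by
  have hd : HasStrictFDerivAt (fun x : E => ‖q - x‖ ^ 2) (-(2 • innerSL ℝ (q - m))) m := by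
    have h1 := (hasStrictFDerivAt_norm_sq (q - m)).comp m
      ((hasStrictFDerivAt_id (𝕜 := ℝ) m).const_sub q)
    refine h1.congr_fderiv ?_
    ext x
    simp
  obtain ⟨μ, hμ⟩ := h.exists_multiplier hmT hmV hd (fun x hx => by
    have := coneDist_le_dist hx q
    rw [hm] at this
    gcongr)
  refine ⟨-(μ / 2), fun x => ?_⟩
  have := hμ x
  simp at this
  rw [inner_sub_left]
  linarith

theorem log_coneDist_add_le (hT : IsLeviFlatCone T) {q h : E} (h0 : 0 < coneDist T q)
    (h1 : 0 < coneDist T (q + h))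
    (h2 : 0 < coneDist T (q - h)) :
    Real.log (coneDist T (q + h)) + Real.log (coneDist T (q - h)) ≤
      2 * Real.log (coneDist T q) + ‖h‖ ^ 2 / coneDist T q ^ 2 := by
  have hq : q ≠ 0 := by
    rintro rfl
    have := coneDist_le_norm T (0 : E)
    simp at this
    linarith
  obtain ⟨m, hm, he⟩ := hT.exists_nearest hq
  have a1 := coneDist_le_dist hm (q + h)
  have a2 := coneDist_le_dist hm (q - h)
  have hp := parallelogram_law_with_norm ℝ (q - m) h
  have e1 : q - m + h = q + h - m := by abel
  have e2 : q - m - h = q - h - m := by abel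
  rw [e1, e2, ← he] at hp
  set D := coneDist T q
  set a := coneDist T (q + h)
  set b := coneDist T (q - h)
  have hab : a * b ≤ D ^ 2 * (1 + ‖h‖ ^ 2 / D ^ 2) := by
    have : D ^ 2 * (1 + ‖h‖ ^ 2 / D ^ 2) = D ^ 2 + ‖h‖ ^ 2 := by field_simp
    rw [this]
    have b1 : a ^ 2 ≤ ‖q + h - m‖ ^ 2 := by gcongr
    have b2 : b ^ 2 ≤ ‖q - h - m‖ ^ 2 := by gcongr
    nlinarith [sq_nonneg (a - b)]
  rw [← Real.log_mul h1.ne' h2.ne']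
  calc Real.log (a * b) ≤ Real.log (D ^ 2 * (1 + ‖h‖ ^ 2 / D ^ 2)) :=
        Real.log_le_log (by positivity) hab
    _ = 2 * Real.log D + Real.log (1 + ‖h‖ ^ 2 / D ^ 2) := by
        rw [Real.log_mul (by positivity) (by positivity), Real.log_pow]; norm_num
    _ ≤ _ := by
        have := Real.log_le_sub_one_of_pos (x := 1 + ‖h‖ ^ 2 / D ^ 2) (by positivity)
        linarith

end IsLeviFlatCone

end Cone

section Oka

open scoped Topology InnerProductSpace
open Filter

attribute [local instance] InnerProductSpace.complexToReal

theorem tendsto_exp_second_order (α β : ℂ) :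
    Tendsto (fun t : ℝ => ((t : ℂ) ^ 2)⁻¹ * (exp (α * t + β * t ^ 2) - 1 - α * t)) (𝓝[>] 0)
      (𝓝 (β + α ^ 2 / 2)) := by
  have hto : Tendsto (fun t : ℝ => t) (𝓝[>] 0) (𝓝 0) := nhdsWithin_le_nhds
  set z : ℝ → ℂ := fun t => α * t + β * t ^ 2 with hz
  have hz0 : Tendsto z (𝓝[>] 0) (𝓝 0) := by
    have : Continuous z := by fun_prop
    have h := (this.tendsto 0).comp hto
    simpa [hz, Function.comp_def] using h
  have hmain : Tendsto (fun t : ℝ => β + (α + β * t) ^ 2 / 2) (𝓝[>] 0) (𝓝 (β + α ^ 2 / 2)) := by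
    have : Continuous (fun t : ℝ => β + (α + β * t) ^ 2 / 2) := by fun_prop
    have h := (this.tendsto 0).comp hto
    simpa [Function.comp_def] using h
  have hrest : Tendsto (fun t : ℝ => ((t : ℂ) ^ 2)⁻¹ * (exp (z t) - 1 - z t - z t ^ 2 / 2))
      (𝓝[>] 0) (𝓝 0) := by
    have hb : Tendsto (fun t : ℝ => t * ‖α + β * t‖ ^ 3) (𝓝[>] 0) (𝓝 0) := by
      have : Continuous (fun t : ℝ => t * ‖α + β * t‖ ^ 3) := by fun_prop
      have h := (this.tendsto 0).comp hto
      simpa [Function.comp_def] using h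
    refine squeeze_zero_norm' ?_ hb
    have h1 : ∀ᶠ t in 𝓝[>] (0 : ℝ), ‖z t‖ ≤ 1 := by
      have := hz0.norm
      rw [norm_zero] at this
      exact this.eventually_le_const one_pos
    filter_upwards [h1, self_mem_nhdsWithin] with t ht ht0
    have ht0' : (0 : ℝ) < t := ht0
    have hb := Complex.exp_bound ht (n := 3) (by norm_num)
    have e1 : ∑ m ∈ Finset.range 3, z t ^ m / (m.factorial : ℂ) = 1 + z t + z t ^ 2 / 2 := by
      simp [Finset.sum_range_succ, Nat.factorial]
    rw [e1] at hb
    have e2 : ‖z t‖ = t * ‖α + β * t‖ := by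
      have : z t = t * (α + β * t) := by simp only [hz]; ring
      rw [this, norm_mul, norm_real, Real.norm_of_nonneg ht0'.le]
    have e3 : exp (z t) - 1 - z t - z t ^ 2 / 2 = exp (z t) - (1 + z t + z t ^ 2 / 2) := by ring
    rw [e3, norm_mul, norm_inv, norm_pow, norm_real, Real.norm_of_nonneg ht0'.le]
    rw [inv_mul_le_iff₀ (by positivity)]
    refine hb.trans ?_
    rw [e2]
    have : (((3 : ℕ).succ : ℝ) * (((3 : ℕ).factorial : ℝ) * (3 : ℕ))⁻¹) ≤ 1 := by
      norm_num [Nat.factorial]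
    calc (t * ‖α + β * t‖) ^ 3 * (((3 : ℕ).succ : ℝ) * (((3 : ℕ).factorial : ℝ) * (3 : ℕ))⁻¹)
        ≤ (t * ‖α + β * t‖) ^ 3 * 1 := by gcongr
      _ = _ := by ring
  have := hmain.add hrest
  rw [add_zero] at this
  refine this.congr' ?_
  filter_upwards [self_mem_nhdsWithin] with t ht0
  have ht0' : (t : ℂ) ≠ 0 := by
    have : (0 : ℝ) < t := ht0
    exact_mod_cast this.ne'
  simp only [hz]
  field_simp
  ring

variable {E : Type*} [NormedAddCommGroup E] [InnerProductSpace ℂ E] [FiniteDimensional ℂ E]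

/-- A curve with velocity `a + α v` tangent to second order to `T` can be corrected, by an
arbitrarily small multiple of `t² v`, so as to lie on `T`. -/
theorem IsDefiningOn.eventually_exists_curve_mem {T V : Set E} {ρ : E → ℝ}
    (h : IsDefiningOn T V ρ) {m v a : E} (hmT : m ∈ T) (hmV : m ∈ V) {α b : ℂ}
    (hv : fderiv ℝ ρ m v ≠ 0) (h1 : fderiv ℝ ρ m (a + α • v) = 0)
    (h2 : fderiv ℝ ρ m ((b + α ^ 2 / 2) • v) +
      1 / 2 * fderiv ℝ (fderiv ℝ ρ) m (a + α • v) (a + α • v) = 0) {ε : ℝ} (hε : 0 < ε) :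
    ∀ᶠ t : ℝ in 𝓝[>] 0, ∃ τ ∈ Icc (-ε) ε,
      m + (t • a + (exp (α * t + (b + (τ : ℝ)) * t ^ 2) - 1) • v) ∈ T := by
  set γ : ℝ → ℝ → E := fun τ t => t • a + (exp (α * t + (b + (τ : ℝ)) * t ^ 2) - 1) • v with hγ
  have hcont : Continuous (fun p : ℝ × ℝ => γ p.1 p.2) := by
    simp only [hγ]
    fun_prop
  have hρm : ρ m = 0 := (h.mem_iff m hmV).1 hmT
  have hlim : ∀ τ : ℝ, Tendsto (fun t => ρ (m + γ τ t) / t ^ 2) (𝓝[>] 0)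
      (𝓝 (τ * fderiv ℝ ρ m v)) := by
    intro τ
    have hc : Tendsto (fun t : ℝ => (t ^ 2)⁻¹ • (γ τ t - t • (a + α • v))) (𝓝[>] 0)
        (𝓝 ((b + τ + α ^ 2 / 2) • v)) := by
      refine ((tendsto_exp_second_order α (b + τ)).smul_const v).congr' ?_
      filter_upwards with t
      simp only [hγ]
      rw [← Complex.coe_smul t, ← Complex.coe_smul t, ← Complex.coe_smul ((t ^ 2)⁻¹)]
      push_cast
      module
    have := tendsto_second_order_curve (h.contDiffAt hmV) hc h1
    rw [hρm] at this
    simp only [sub_zero] at this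
    convert this using 2
    have e : (b + τ + α ^ 2 / 2) • v = (b + α ^ 2 / 2) • v + τ • v := by
      rw [← Complex.coe_smul τ]; module
    rw [e, map_add, (fderiv ℝ ρ m).map_smul τ v, smul_eq_mul]
    linarith
  have hsign : ∀ τ : ℝ, 0 < τ * τ → ∀ᶠ t in 𝓝[>] (0 : ℝ),
      0 < (τ * fderiv ℝ ρ m v) * ρ (m + γ τ t) := by
    intro τ hτ
    have h3 := (hlim τ).const_mul (τ * fderiv ℝ ρ m v)
    have h4 : 0 < (τ * fderiv ℝ ρ m v) * (τ * fderiv ℝ ρ m v) := by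
      have : τ ≠ 0 := by rintro rfl; simp at hτ
      exact mul_self_pos.2 (mul_ne_zero this hv)
    filter_upwards [h3.eventually_const_lt h4, self_mem_nhdsWithin] with t ht ht0
    have ht0' : (0 : ℝ) < t := ht0
    rw [← mul_div_assoc] at ht
    have := mul_pos ht (pow_pos ht0' 2)
    rwa [div_mul_cancel₀ _ (by positivity)] at this
  have hV : ∀ᶠ t in 𝓝[>] (0 : ℝ), ∀ τ ∈ Icc (-ε) ε, m + γ τ t ∈ V := by
    apply nhdsWithin_le_nhds
    refine isCompact_Icc.eventually_forall_of_forall_eventually (x₀ := (0 : ℝ))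
      (P := fun t τ => m + γ τ t ∈ V) fun τ _ => ?_
    have hc : Continuous (fun p : ℝ × ℝ => m + γ p.2 p.1) :=
      continuous_const.add (hcont.comp continuous_swap)
    refine hc.continuousAt.eventually_mem (h.isOpen.mem_nhds ?_)
    simpa [hγ] using hmV
  filter_upwards [hV, hsign ε (by positivity), hsign (-ε) (by nlinarith)] with t htV h3 h4
  have hcon : ContinuousOn (fun τ => fderiv ℝ ρ m v * ρ (m + γ τ t)) (Icc (-ε) ε) := by
    refine continuousOn_const.mul (h.contDiffOn.continuousOn.comp ?_ htV)
    exact (continuous_const.add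
      (hcont.comp (by fun_prop : Continuous fun τ : ℝ => (τ, t)))).continuousOn
  have hiv := intermediate_value_Icc (by linarith : -ε ≤ ε) hcon
  have hz : (0 : ℝ) ∈ Icc (fderiv ℝ ρ m v * ρ (m + γ (-ε) t)) (fderiv ℝ ρ m v * ρ (m + γ ε t)) := by
    constructor
    · by_contra! hh
      nlinarith
    · by_contra! hh
      nlinarith
  obtain ⟨τ, hτ, hτ0⟩ := hiv hz
  refine ⟨τ, hτ, (h.mem_iff _ (htV τ hτ)).2 ?_⟩
  exact (mul_eq_zero.1 hτ0).resolve_left hv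

namespace IsLeviFlatCone

variable {T : Set E}

/-- Oka's lemma: `-log` of the distance to a Levi-flat cone has nonnegative Laplacian along every
complex line, in an infinitesimal sense. -/
theorem eventually_log_coneDist_le (hT : IsLeviFlatCone T) {q : E} (hq : 0 < coneDist T q)
    (w : E) {ε : ℝ} (hε : 0 < ε) :
    ∀ᶠ t : ℝ in 𝓝[>] 0,
      Real.log (coneDist T (q + t • w)) + Real.log (coneDist T (q - t • w)) +
        (Real.log (coneDist T (q + t • I • w)) + Real.log (coneDist T (q - t • I • w))) ≤
      4 * Real.log (coneDist T q) + ε * t ^ 2 := by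
  have hq0 : q ≠ 0 := by
    rintro rfl
    have := coneDist_le_norm T (0 : E)
    simp at this
    linarith
  obtain ⟨m, hm, he⟩ := hT.exists_nearest hq0
  obtain ⟨V, ρ, hmV, hρ, hLevi⟩ := hT.exists_defining m hm
  obtain ⟨μ, hμ⟩ := hρ.exists_multiplier_nearest hm hmV he
  set ℓ := fderiv ℝ ρ m with hℓ
  set H := fderiv ℝ (fderiv ℝ ρ) m with hH
  set v := m - q with hv
  have hDv : coneDist T q = ‖v‖ := by rw [he, hv, norm_sub_rev]
  have e1 : -‖v‖ ^ 2 = μ * ℓ v := by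
    rw [← hμ, ← neg_sub, ← hv, inner_neg_left, real_inner_self_eq_norm_sq]
  have e2 : 0 = μ * ℓ (I • v) := by
    rw [← hμ, ← neg_sub, ← hv, inner_neg_left, real_inner_eq_re_inner ℂ, inner_smul_right,
      inner_self_eq_norm_sq_to_K]
    simp [← ofReal_pow]
  have hv0 : 0 < ‖v‖ := hDv ▸ hq
  have hμ0 : μ ≠ 0 := by
    rintro rfl
    rw [zero_mul] at e1
    nlinarith
  have hℓv : ℓ v ≠ 0 := by
    intro h
    rw [h, mul_zero] at e1
    nlinarith
  have hℓIv : ℓ (I • v) = 0 := by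
    rcases mul_eq_zero.1 e2.symm with h | h
    · exact absurd h hμ0
    · exact h
  set α : ℂ := ((-ℓ w / ℓ v : ℝ) : ℂ) + ((ℓ (I • w) / ℓ v : ℝ) : ℂ) * I with hα
  set g := w + α • v with hg
  have hg1 : ℓ g = 0 := by
    have : g = w + ((-ℓ w / ℓ v : ℝ) • v + (ℓ (I • w) / ℓ v : ℝ) • I • v) := by
      rw [hg, hα, add_smul, mul_smul, Complex.coe_smul, Complex.coe_smul]
    rw [this, map_add, map_add, map_smul, map_smul, hℓIv, smul_eq_mul, smul_zero, add_zero]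
    field_simp
    ring
  have hg2 : ℓ (I • g) = 0 := by
    have : I • g = I • w + ((-ℓ w / ℓ v : ℝ) • I • v - (ℓ (I • w) / ℓ v : ℝ) • v) := by
      rw [hg, hα, ← Complex.coe_smul, ← Complex.coe_smul, smul_add, smul_smul, mul_add, add_smul]
      rw [show I * (((ℓ (I • w) / ℓ v : ℝ) : ℂ) * I) = -((ℓ (I • w) / ℓ v : ℝ) : ℂ) by
        linear_combination ((ℓ (I • w) / ℓ v : ℝ) : ℂ) * I_mul_I]
      module
    rw [this, map_add, map_sub, ℓ.map_smul, ℓ.map_smul, hℓIv, smul_eq_mul, smul_eq_mul, mul_zero,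
      zero_sub]
    field_simp
    ring
  have hLg := hLevi g hg1 hg2
  set r : ℝ := -(H g g) / (2 * ℓ v) with hr
  set b : ℂ := r - α ^ 2 / 2 with hb
  have hcont := continuous_coneDist T
  have key : ∀ c : ℂ, (c ^ 2 = 1 ∨ c ^ 2 = -1) → ℓ (c • g) = 0 → H (c • g) (c • g) =
      (c ^ 2).re * H g g → ∀ᶠ t : ℝ in 𝓝[>] 0, Real.log (coneDist T (q + t • c • w)) ≤
        Real.log (coneDist T q) + (c * α).re * t + (c ^ 2 * b).re * t ^ 2 + ε / 4 * t ^ 2 := by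
    intro c hc hcg hHc
    have hag : c • w + (c * α) • v = c • g := by rw [hg]; module
    have hcr : c ^ 2 = (((c ^ 2).re : ℝ) : ℂ) := by rcases hc with h | h <;> rw [h] <;> simp
    have h2 : ℓ ((c ^ 2 * b + (c * α) ^ 2 / 2) • v) +
        1 / 2 * H (c • w + (c * α) • v) (c • w + (c * α) • v) = 0 := by
      have : (c ^ 2 * b + (c * α) ^ 2 / 2) = (((c ^ 2).re * r : ℝ) : ℂ) := by
        push_cast
        rw [← hcr, hb]
        ring
      rw [hag, this, Complex.coe_smul, map_smul, hHc, smul_eq_mul, hr]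
      field_simp
      ring
    have hpos : ∀ᶠ t : ℝ in 𝓝[>] 0, 0 < coneDist T (q + t • c • w) := by
      apply nhdsWithin_le_nhds
      have hc' : Continuous (fun t : ℝ => coneDist T (q + t • c • w)) :=
        hcont.comp (by fun_prop)
      exact hc'.continuousAt.eventually_const_lt (by simpa using hq)
    filter_upwards [hρ.eventually_exists_curve_mem hm hmV hℓv (a := c • w) (α := c * α)
      (b := c ^ 2 * b) (by rw [hag]; exact hcg) h2 (ε := ε / 4) (by positivity), hpos,
      self_mem_nhdsWithin] with t ⟨τ, hτ, hmem⟩ hp ht0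
    have hle := coneDist_le_dist hmem (q + t • c • w)
    have : q + t • c • w - (m + (t • c • w +
        (exp (c * α * t + (c ^ 2 * b + (τ : ℝ)) * t ^ 2) - 1) • v)) =
        -(exp (c * α * t + (c ^ 2 * b + (τ : ℝ)) * t ^ 2) • v) := by
      rw [hv]; module
    rw [this, norm_neg, norm_smul, ← hDv, norm_exp] at hle
    have hlog := Real.log_le_log hp hle
    rw [Real.log_mul (Real.exp_pos _).ne' hq.ne', Real.log_exp] at hlog
    refine hlog.trans ?_
    have e : (c * α * t + (c ^ 2 * b + (τ : ℝ)) * t ^ 2).re =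
        (c * α).re * t + (c ^ 2 * b).re * t ^ 2 + τ * t ^ 2 := by
      rw [add_re, re_mul_ofReal, ← ofReal_pow, re_mul_ofReal, add_re, ofReal_re]
      ring
    rw [e]
    have := mul_le_mul_of_nonneg_right hτ.2 (sq_nonneg t)
    linarith
  have hHn : ∀ x, H (-x) (-x) = H x x := by intro x; simp
  filter_upwards [key 1 (by simp) (by simpa using hg1) (by simp),
    key (-1) (by simp) (by simpa using hg1) (by simp),
    key I (by simp) hg2 (by simp; linarith),
    key (-I) (by simp) (by simpa using hg2) (by simp; linarith)] with t k1 k2 k3 k4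
  have f2 : q + t • (-1 : ℂ) • w = q - t • w := by
    rw [neg_smul, one_smul, smul_neg, sub_eq_add_neg]
  have f4 : q + t • (-I : ℂ) • w = q - t • I • w := by
    rw [neg_smul, smul_neg, sub_eq_add_neg]
  rw [f2] at k2
  rw [f4] at k4
  rw [one_smul] at k1
  simp at k1 k2 k3 k4
  linarith

end IsLeviFlatCone

end Oka

section Mollifier

open scoped Topology InnerProductSpace
open Filter MeasureTheory

/-- A smooth probability measure concentrated on a small ball, for mollifying functions. -/
theorem exists_mollifier (E : Type*) [NormedAddCommGroup E] [NormedSpace ℝ E]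
    [FiniteDimensional ℝ E] [MeasurableSpace E] [BorelSpace E] {r : ℝ} (hr : 0 < r) :
    ∃ ν : Measure E, IsProbabilityMeasure ν ∧ (∀ᵐ y ∂ν, ‖y‖ ≤ r) ∧
      ∀ u : E → ℝ, Continuous u → ContDiff ℝ 2 (fun x => ∫ y, u (x - y) ∂ν) := by
  let b : ContDiffBump (0 : E) := ⟨r / 2, r, by positivity, by linarith⟩
  set μ : Measure E := Measure.addHaar
  set χ := b.normed μ with hχ
  have hm : Measurable (fun y => (χ y).toNNReal) :=
    (b.continuous_normed.measurable).real_toNNReal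
  set ν := μ.withDensity (fun y => ((χ y).toNNReal : ENNReal)) with hν
  have hint : ∀ u : E → ℝ, ∫ y, u y ∂ν = ∫ y, χ y * u y ∂μ := by
    intro u
    rw [hν, integral_withDensity_eq_integral_smul hm]
    refine integral_congr_ae (Eventually.of_forall fun y => ?_)
    simp only [NNReal.smul_def, smul_eq_mul]
    rw [Real.coe_toNNReal _ (b.nonneg_normed y)]
  refine ⟨ν, ⟨?_⟩, ?_, ?_⟩
  · rw [hν, withDensity_apply _ MeasurableSet.univ, Measure.restrict_univ]
    have := ofReal_integral_eq_lintegral_ofReal (μ := μ) b.integrable_normed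
      (Eventually.of_forall b.nonneg_normed)
    rw [b.integral_normed, ENNReal.ofReal_one] at this
    exact this.symm
  · rw [hν, ae_withDensity_iff (by fun_prop)]
    refine Eventually.of_forall fun y hy => ?_
    by_contra! hlt
    have : y ∉ Function.support χ := by
      rw [hχ, b.support_normed_eq]
      simpa [b] using hlt.le
    simp only [Function.mem_support, not_not] at this
    simp [this] at hy
  · intro u hu
    have := (b.hasCompactSupport_normed (μ := μ)).contDiff_convolution_left
      (ContinuousLinearMap.lsmul ℝ ℝ) (b.contDiff_normed (n := 2)) (hu.locallyIntegrable (μ := μ))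
    have e : (fun x => ∫ y, u (x - y) ∂ν) =
        convolution χ u (ContinuousLinearMap.lsmul ℝ ℝ) μ := by
      funext x
      rw [hint]
      rfl
    rw [e]
    exact_mod_cast this

theorem Continuous.integrable_of_ae_norm_le {E : Type*} [NormedAddCommGroup E] [ProperSpace E]
    [MeasurableSpace E] [BorelSpace E] {ν : Measure E} [IsFiniteMeasure ν] {r : ℝ}
    (hν : ∀ᵐ y ∂ν, ‖y‖ ≤ r) {f : E → ℝ} (hf : Continuous f) : Integrable f ν := by
  obtain ⟨C, hC⟩ := (isCompact_closedBall (0 : E) r).exists_bound_of_continuousOn hf.continuousOn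
  refine Integrable.of_bound hf.aestronglyMeasurable C ?_
  filter_upwards [hν] with y hy
  exact hC y (by simpa using hy)

end Mollifier

section Smoothing

set_option linter.unusedSectionVars false
open scoped Topology InnerProductSpace
open Filter MeasureTheory

attribute [local instance] InnerProductSpace.complexToReal

variable {E : Type*} [NormedAddCommGroup E] [InnerProductSpace ℂ E] [FiniteDimensional ℂ E]

/-- The second difference of `u` at `x` along the complex line spanned by `w`. -/
def complexSecondDiff (u : E → ℝ) (x w : E) (t : ℝ) : ℝ :=
  u (x + t • w) + u (x - t • w) + (u (x + t • I • w) + u (x - t • I • w)) - 4 * u x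

theorem tendsto_secondDiff {f : E → ℝ} {p : E} (hf : ContDiffAt ℝ 2 f p) (w : E) :
    Tendsto (fun t : ℝ => (f (p + t • w) + f (p - t • w) - 2 * f p) / t ^ 2) (𝓝[>] 0)
      (𝓝 (fderiv ℝ (fderiv ℝ f) p w w)) := by
  have hto : Tendsto (fun t : ℝ => t) (𝓝[>] 0) (𝓝 0) := nhdsWithin_le_nhds
  have key : ∀ v : E, Tendsto (fun t : ℝ => (f (p + t • v) - f p - fderiv ℝ f p (t • v) -
      1 / 2 * fderiv ℝ (fderiv ℝ f) p (t • v) (t • v)) / t ^ 2) (𝓝[>] 0) (𝓝 0) := by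
    intro v
    have h0 : Tendsto (fun t : ℝ => t • v) (𝓝[>] 0) (𝓝 0) := by
      simpa using hto.smul_const v
    have h1 := (isLittleO_taylor_two hf).comp_tendsto h0
    have h2 : (fun t : ℝ => ‖t • v‖ ^ 2) =O[𝓝[>] 0] (fun t : ℝ => t ^ 2) := by
      refine Asymptotics.IsBigO.of_bound (‖v‖ ^ 2) (Eventually.of_forall fun t => ?_)
      simp only [norm_smul, norm_pow, norm_norm, norm_mul]
      apply le_of_eq
      ring
    exact (h1.trans_isBigO h2).tendsto_div_nhds_zero
  have := (((key w).add (key (-w))).add_const (fderiv ℝ (fderiv ℝ f) p w w))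
  rw [add_zero, zero_add] at this
  refine this.congr' ?_
  filter_upwards [self_mem_nhdsWithin] with t ht
  have ht0 : t ≠ 0 := (show (0 : ℝ) < t from ht).ne'
  simp only [map_smul, map_neg, smul_neg, smul_apply, neg_apply, smul_eq_mul, ← sub_eq_add_neg]
  field_simp
  ring

theorem tendsto_complexSecondDiff {f : E → ℝ} {p : E} (hf : ContDiffAt ℝ 2 f p) (w : E) :
    Tendsto (fun t : ℝ => complexSecondDiff f p w t / t ^ 2) (𝓝[>] 0)
      (𝓝 (fderiv ℝ (fderiv ℝ f) p w w + fderiv ℝ (fderiv ℝ f) p (I • w) (I • w))) := by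
  refine ((tendsto_secondDiff hf w).add (tendsto_secondDiff hf (I • w))).congr fun t => ?_
  rw [complexSecondDiff]
  ring

/-- Minus the logarithm of the distance to the cone, truncated at distance `κ`. -/
def truncLog (T : Set E) (κ : ℝ) (q : E) : ℝ := -Real.log (max (coneDist T q) κ)

theorem continuous_truncLog (T : Set E) {κ : ℝ} (hκ : 0 < κ) : Continuous (truncLog T κ) :=
  (((continuous_coneDist T).max continuous_const).log fun _ =>
    (lt_max_of_lt_right hκ).ne').neg

theorem truncLog_of_le {T : Set E} {κ : ℝ} {q : E} (h : κ ≤ coneDist T q) :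
    truncLog T κ q = -Real.log (coneDist T q) := by
  rw [truncLog, max_eq_left h]

theorem neg_log_le_truncLog {T : Set E} {κ B : ℝ} {q : E} (hκ : 0 < κ) (h1 : coneDist T q ≤ B)
    (h2 : κ ≤ B) : -Real.log B ≤ truncLog T κ q :=
  neg_le_neg (Real.log_le_log (lt_max_of_lt_right hκ) (max_le h1 h2))

theorem truncLog_le {T : Set E} {κ B : ℝ} {q : E} (hB : 0 < B) (h1 : B ≤ coneDist T q) :
    truncLog T κ q ≤ -Real.log B :=
  neg_le_neg (Real.log_le_log hB (le_max_of_le_left h1))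

namespace IsLeviFlatCone

variable {T : Set E}

theorem le_coneDist_add {κ : ℝ} {x h : E} (hx : 2 * κ ≤ coneDist T x) (hh : ‖h‖ ≤ κ / 2) :
    3 / 2 * κ ≤ coneDist T (x + h) := by
  have := coneDist_sub_le T x h
  linarith

theorem complexSecondDiff_truncLog {κ : ℝ} {x w : E} (hx : 2 * κ ≤ coneDist T x)
    (hw : ‖w‖ = 1) {t : ℝ} (ht0 : 0 < t) (ht : t ≤ κ / 2) :
    complexSecondDiff (truncLog T κ) x w t = 4 * Real.log (coneDist T x) -
      (Real.log (coneDist T (x + t • w)) + Real.log (coneDist T (x - t • w)) +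
        (Real.log (coneDist T (x + t • I • w)) + Real.log (coneDist T (x - t • I • w)))) := by
  have n1 : ‖t • w‖ ≤ κ / 2 := by rwa [norm_smul, hw, Real.norm_of_nonneg ht0.le, mul_one]
  have n2 : ‖t • I • w‖ ≤ κ / 2 := by
    rwa [norm_smul, norm_smul, hw, Real.norm_of_nonneg ht0.le, norm_I, mul_one, mul_one]
  have key : ∀ h : E, ‖h‖ ≤ κ / 2 → κ ≤ coneDist T (x + h) := fun h hh => by
    linarith [le_coneDist_add hx hh]
  have k1 := key (-(t • w)) (by rwa [norm_neg])
  have k2 := key (-(t • I • w)) (by rwa [norm_neg])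
  rw [← sub_eq_add_neg] at k1 k2
  rw [complexSecondDiff, truncLog_of_le (key _ n1), truncLog_of_le (key _ n2), truncLog_of_le k1,
    truncLog_of_le k2, truncLog_of_le (by linarith)]
  ring

theorem le_complexSecondDiff_truncLog (hT : IsLeviFlatCone T) {κ : ℝ} (hκ : 0 < κ) {x w : E}
    (hx : 2 * κ ≤ coneDist T x) (hw : ‖w‖ = 1) {t : ℝ} (ht0 : 0 < t) (ht : t ≤ κ / 2) :
    -(t ^ 2 / κ ^ 2) ≤ complexSecondDiff (truncLog T κ) x w t := by
  rw [complexSecondDiff_truncLog hx hw ht0 ht]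
  have n1 : ‖t • w‖ = t := by rw [norm_smul, hw, Real.norm_of_nonneg ht0.le, mul_one]
  have n2 : ‖t • I • w‖ = t := by
    rw [norm_smul, norm_smul, hw, Real.norm_of_nonneg ht0.le, norm_I, mul_one, mul_one]
  have key : ∀ h : E, ‖h‖ = t → Real.log (coneDist T (x + h)) + Real.log (coneDist T (x - h)) ≤
      2 * Real.log (coneDist T x) + t ^ 2 / (4 * κ ^ 2) := by
    intro h hh
    have k1 := le_coneDist_add hx (hh.le.trans ht)
    have k2 := le_coneDist_add hx (h := -h) (by rw [norm_neg, hh]; exact ht)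
    rw [← sub_eq_add_neg] at k2
    refine (hT.log_coneDist_add_le (by linarith) (by linarith) (by linarith)).trans ?_
    rw [hh]
    gcongr
    nlinarith
  have e1 := key _ n1
  have e2 := key _ n2
  have e3 : t ^ 2 / (4 * κ ^ 2) ≤ t ^ 2 / κ ^ 2 / 2 := by
    rw [div_div]
    exact div_le_div_of_nonneg_left (by positivity) (by positivity) (by nlinarith)
  linarith

theorem eventually_le_complexSecondDiff_truncLog (hT : IsLeviFlatCone T) {κ : ℝ} (hκ : 0 < κ)
    {x w : E}
    (hx : 2 * κ ≤ coneDist T x) (hw : ‖w‖ = 1) {ε : ℝ} (hε : 0 < ε) :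
    ∀ᶠ t : ℝ in 𝓝[>] 0, -(ε * t ^ 2) ≤ complexSecondDiff (truncLog T κ) x w t := by
  filter_upwards [hT.eventually_log_coneDist_le (q := x) (by linarith) w hε,
    self_mem_nhdsWithin, Ioc_mem_nhdsGT (show (0 : ℝ) < κ / 2 by positivity)] with t h1 h2 h3
  rw [complexSecondDiff_truncLog hx hw h2 h3.2]
  linarith

theorem continuous_complexSecondDiff {u : E → ℝ} (hu : Continuous u) (x w : E) (t : ℝ) :
    Continuous (fun y => complexSecondDiff u (x - y) w t) := by
  unfold complexSecondDiff
  fun_prop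

theorem eventually_le_integral_complexSecondDiff (hT : IsLeviFlatCone T) [MeasurableSpace E]
    [BorelSpace E]
    {ν : Measure E} [IsProbabilityMeasure ν] {κ : ℝ} (hκ : 0 < κ)
    (hν : ∀ᵐ y ∂ν, ‖y‖ ≤ κ / 4) {q w : E} (hq : 3 * κ ≤ coneDist T q) (hw : ‖w‖ = 1) :
    ∀ᶠ t : ℝ in 𝓝[>] 0,
      -(t ^ 2 / 4) ≤ ∫ y, complexSecondDiff (truncLog T κ) (q - y) w t ∂ν := by
  have : ProperSpace E := FiniteDimensional.proper ℂ E
  set F : ℝ → E → ℝ := fun t y => complexSecondDiff (truncLog T κ) (q - y) w t with hF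
  have hFc : ∀ t, Continuous (F t) := fun t =>
    continuous_complexSecondDiff (continuous_truncLog T hκ) q w t
  have hx : ∀ y : E, ‖y‖ ≤ κ / 4 → 2 * κ ≤ coneDist T (q - y) := by
    intro y hy
    have := coneDist_sub_le T q (-y)
    rw [norm_neg, ← sub_eq_add_neg] at this
    linarith
  have hlim : Tendsto (fun t => ∫ y, min (F t y / t ^ 2) 0 ∂ν) (𝓝[>] 0) (𝓝 (∫ _, (0 : ℝ) ∂ν)) := by
    refine tendsto_integral_filter_of_dominated_convergence (fun _ => 1 / κ ^ 2) ?_ ?_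
      (integrable_const _) ?_
    · exact Eventually.of_forall fun t =>
        (((hFc t).div_const _).min continuous_const).aestronglyMeasurable
    · filter_upwards [Ioc_mem_nhdsGT (show (0 : ℝ) < κ / 2 by positivity)] with t ht
      filter_upwards [hν] with y hy
      have h1 := hT.le_complexSecondDiff_truncLog hκ (hx y hy) hw ht.1 ht.2
      have h2 : -(1 / κ ^ 2) ≤ F t y / t ^ 2 := by
        rw [le_div_iff₀ (pow_pos ht.1 2)]
        refine le_trans (le_of_eq ?_) h1
        ring
      rw [Real.norm_eq_abs, abs_of_nonpos (min_le_right _ _), neg_le]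
      refine le_min h2 ?_
      rw [neg_nonpos]
      positivity
    · filter_upwards [hν] with y hy
      rw [Metric.tendsto_nhds]
      intro ε hε
      filter_upwards [hT.eventually_le_complexSecondDiff_truncLog hκ (hx y hy) hw (half_pos hε),
        self_mem_nhdsWithin] with t h1 h2
      have h2' : (0 : ℝ) < t := h2
      have h3 : -(ε / 2) ≤ F t y / t ^ 2 := by
        rw [le_div_iff₀ (pow_pos h2' 2)]
        linarith
      rw [Real.dist_eq, sub_zero, abs_of_nonpos (min_le_right _ _), neg_lt]
      exact lt_min (by linarith) (by linarith)
  rw [integral_zero] at hlim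
  filter_upwards [hlim.eventually_const_le (show (-(1 / 4) : ℝ) < 0 by norm_num),
    self_mem_nhdsWithin] with t h1 h2
  have h2' : (0 : ℝ) < t := h2
  have h3 : ∫ y, min (F t y / t ^ 2) 0 ∂ν ≤ ∫ y, F t y / t ^ 2 ∂ν :=
    integral_mono ((((hFc t).div_const _).min continuous_const).integrable_of_ae_norm_le hν)
      (((hFc t).div_const _).integrable_of_ae_norm_le hν) fun y => min_le_left _ _
  rw [integral_div] at h3
  have h4 := h1.trans h3
  rw [le_div_iff₀ (pow_pos h2' 2)] at h4
  linarith

theorem truncLog_normalize (hT : IsLeviFlatCone T) {κ : ℝ} (hκ : 0 < κ) {q h y : E} (hq1 : ‖q‖ = 1)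
    (hq : 3 * κ ≤ coneDist T q) (hqh : ⟪q, h⟫_ℝ = 0) (hh : ‖h‖ ≤ κ / 4) (hh1 : ‖h‖ ≤ 1)
    (hy : ‖y‖ ≤ κ / 4) :
    truncLog T κ (q - y + h) + ‖h‖ ^ 2 / 8 ≤ truncLog T κ (‖q + h‖⁻¹ • (q + h) - y) := by
  set s := ‖q + h‖ with hs
  have hs2 : s ^ 2 = 1 + ‖h‖ ^ 2 := by
    have := norm_add_sq_eq_norm_sq_add_norm_sq_of_inner_eq_zero _ _ hqh
    rw [hq1, ← hs] at this
    nlinarith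
  have hs0 : 0 ≤ s := norm_nonneg _
  have hs1 : 1 ≤ s := by nlinarith [sq_nonneg ‖h‖]
  have hs3 : s - 1 ≤ ‖h‖ ^ 2 / 2 := by nlinarith [sq_nonneg (s - 1)]
  have hs4 : s ≤ 2 := by nlinarith [norm_nonneg h]
  set d := coneDist T (q - y + h) with hd
  have hd0 : 2 * κ ≤ d := by
    have := coneDist_sub_le T q (-y + h)
    rw [← add_assoc, ← sub_eq_add_neg] at this
    have h2 := norm_add_le (-y) h
    rw [norm_neg] at h2
    linarith
  have hB : coneDist T (s⁻¹ • (q + h) - y) ≤ s⁻¹ * (d + (s - 1) * (κ / 4)) := by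
    have e : s⁻¹ • (q + h) - y = ((s⁻¹ : ℝ) : ℂ) • (q - y + h + (1 - s) • y) := by
      have h1 : s⁻¹ * s = 1 := inv_mul_cancel₀ (by linarith)
      have h2 : y = s⁻¹ • s • y := by rw [smul_smul, h1, one_smul]
      rw [Complex.coe_smul]
      nth_rw 1 [h2]
      module
    rw [e, hT.coneDist_smul (by rw [Ne, ofReal_eq_zero]; exact inv_ne_zero (by linarith)),
      norm_real,
      norm_inv, Real.norm_of_nonneg hs0]
    gcongr
    refine (coneDist_le_add T _ _).trans ?_
    rw [norm_smul, Real.norm_eq_abs, abs_sub_comm, abs_of_nonneg (by linarith)]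
    gcongr
  have hpos : 0 < d + (s - 1) * (κ / 4) := by nlinarith
  have h1 := neg_log_le_truncLog hκ hB (by
    rw [← div_eq_inv_mul, le_div_iff₀ (by linarith)]
    nlinarith)
  refine le_trans ?_ h1
  rw [truncLog_of_le (by linarith : κ ≤ coneDist T (q - y + h)), ← hd,
    Real.log_mul (inv_ne_zero (by linarith)) hpos.ne', Real.log_inv]
  have h2 : Real.log (d + (s - 1) * (κ / 4)) ≤ Real.log d + (s - 1) / 8 := by
    have e : d + (s - 1) * (κ / 4) = d * (1 + (s - 1) * (κ / 4) / d) := by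
      rw [mul_add, mul_one, mul_div_cancel₀ _ (by linarith)]
    have h3 : (s - 1) * (κ / 4) / d ≤ (s - 1) / 8 := by
      rw [div_le_iff₀ (by linarith)]
      nlinarith
    have h4 : 0 ≤ (s - 1) * (κ / 4) / d :=
      div_nonneg (mul_nonneg (by linarith) (by linarith)) (by linarith)
    rw [e, Real.log_mul (by linarith) (by linarith)]
    have := Real.log_le_sub_one_of_pos (x := 1 + (s - 1) * (κ / 4) / d) (by linarith)
    linarith
  have h3 : ‖h‖ ^ 2 / 4 ≤ Real.log s := by
    have e : Real.log (s ^ 2) = 2 * Real.log s := by rw [Real.log_pow]; norm_num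
    have h4 := Real.one_sub_inv_le_log_of_pos (x := s ^ 2) (by positivity)
    rw [e, hs2] at h4
    have h5 : ‖h‖ ^ 2 / 2 ≤ 1 - (1 + ‖h‖ ^ 2)⁻¹ := by
      rw [← one_div, le_sub_iff_add_le, ← le_sub_iff_add_le', div_le_iff₀ (by positivity)]
      nlinarith [norm_nonneg h, sq_nonneg ‖h‖,
        mul_nonneg (sq_nonneg ‖h‖) (sub_nonneg.2 (show ‖h‖ ^ 2 ≤ 1 by nlinarith [norm_nonneg h]))]
    linarith
  nlinarith

/-- A Levi-flat cone has a potential on the unit sphere, close to `-log` of the distance, which is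
strictly subharmonic along the complex lines tangent to the sphere away from the cone. -/
theorem exists_potential (hT : IsLeviFlatCone T) {κ : ℝ} (hκ : 0 < κ) : ∃ Φ : E → ℝ,
    (∀ x ≠ 0, ContDiffAt ℝ 2 Φ x) ∧ (∀ x ≠ 0, Φ (‖x‖⁻¹ • x) = Φ x) ∧
    (∀ q, ‖q‖ = 1 → coneDist T q ≤ 3 * κ → -Real.log (4 * κ) ≤ Φ q) ∧
    (∀ q, ‖q‖ = 1 → 6 * κ ≤ coneDist T q → Φ q ≤ -Real.log (5 * κ)) ∧
    (∀ q ∈ T, ‖q‖ = 1 → -Real.log (2 * κ) ≤ Φ q) ∧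
    ∀ q, ‖q‖ = 1 → 3 * κ ≤ coneDist T q → ∀ w, ⟪q, w⟫_ℂ = 0 → w ≠ 0 →
      0 < fderiv ℝ (fderiv ℝ Φ) q w w + fderiv ℝ (fderiv ℝ Φ) q (I • w) (I • w) := by
  have : ProperSpace E := FiniteDimensional.proper ℂ E
  have : FiniteDimensional ℝ E := FiniteDimensional.complexToReal E
  borelize E
  obtain ⟨ν, hν1, hν, hνc⟩ := exists_mollifier E (show (0 : ℝ) < κ / 4 by positivity)
  have huc := continuous_truncLog T hκ
  set u := truncLog T κ with hu
  have hui : ∀ x, Integrable (fun y => u (x - y)) ν := fun x =>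
    (huc.comp (by fun_prop)).integrable_of_ae_norm_le hν
  set Φ : E → ℝ := fun x => ∫ y, u (‖x‖⁻¹ • x - y) ∂ν with hΦ
  have hΦ1 : ∀ q, ‖q‖ = 1 → Φ q = ∫ y, u (q - y) ∂ν := by
    intro q hq
    simp only [hΦ, hq, inv_one, one_smul]
  have lower : ∀ q, ‖q‖ = 1 → ∀ B, κ ≤ B → coneDist T q + κ / 4 ≤ B → -Real.log B ≤ Φ q := by
    intro q hq B hB h
    rw [hΦ1 q hq]
    have : ∫ _, -Real.log B ∂ν ≤ ∫ y, u (q - y) ∂ν := by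
      refine integral_mono_ae (integrable_const _) (hui q) ?_
      filter_upwards [hν] with y hy
      refine neg_log_le_truncLog hκ ?_ hB
      have := coneDist_le_add T q (-y)
      rw [norm_neg, ← sub_eq_add_neg] at this
      linarith
    simpa using this
  have hsm : ∀ x ≠ 0, ContDiffAt ℝ 2 Φ x := by
    intro x hx
    have h1 : ContDiffAt ℝ 2 (fun x : E => ‖x‖⁻¹ • x) x :=
      ((contDiffAt_norm ℝ hx).inv (norm_ne_zero_iff.2 hx)).smul contDiffAt_id
    exact ContDiffAt.comp (f := fun x : E => ‖x‖⁻¹ • x) x (hνc u huc).contDiffAt h1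
  refine ⟨Φ, hsm, ?_, ?_, ?_, ?_, ?_⟩
  · intro x hx
    have : ‖‖x‖⁻¹ • x‖ = 1 := by
      rw [norm_smul, norm_inv, norm_norm, inv_mul_cancel₀ (norm_ne_zero_iff.2 hx)]
    rw [hΦ1 _ this]
  · exact fun q hq h => lower q hq _ (by linarith) (by linarith)
  · intro q hq h
    rw [hΦ1 q hq]
    have : ∫ y, u (q - y) ∂ν ≤ ∫ _, -Real.log (5 * κ) ∂ν := by
      refine integral_mono_ae (hui q) (integrable_const _) ?_
      filter_upwards [hν] with y hy
      refine truncLog_le (by positivity) ?_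
      have := coneDist_sub_le T q (-y)
      rw [norm_neg, ← sub_eq_add_neg] at this
      linarith
    simpa using this
  · exact fun q hqT hq => lower q hq _ (by linarith) (by
      rw [coneDist_eq_zero_of_mem hqT]; linarith)
  · intro q hq hqd w hqw hw
    have hq0 : q ≠ 0 := by rintro rfl; simp at hq
    have unit : ∀ w, ⟪q, w⟫_ℂ = 0 → ‖w‖ = 1 →
        0 < fderiv ℝ (fderiv ℝ Φ) q w w + fderiv ℝ (fderiv ℝ Φ) q (I • w) (I • w) := by
      intro w hqw hw
      have hev : ∀ᶠ t : ℝ in 𝓝[>] 0, 1 / 4 ≤ complexSecondDiff Φ q w t / t ^ 2 := by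
        filter_upwards [hT.eventually_le_integral_complexSecondDiff hκ hν hqd hw,
          Ioc_mem_nhdsGT (show (0 : ℝ) < κ / 4 by positivity),
          Ioc_mem_nhdsGT (show (0 : ℝ) < 1 by positivity)] with t h1 h2 h3
        have ht : 0 < t := h2.1
        have shift : ∀ h, ⟪q, h⟫_ℂ = 0 → ‖h‖ = t →
            ∫ y, u (q - y + h) ∂ν + t ^ 2 / 8 ≤ Φ (q + h) := by
          intro h hqh hh
          have hi : Integrable (fun y => u (q - y + h)) ν :=
            (huc.comp (by fun_prop)).integrable_of_ae_norm_le hν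
          have : ∫ y, (u (q - y + h) + t ^ 2 / 8) ∂ν ≤ Φ (q + h) := by
            refine integral_mono_ae (hi.add (integrable_const _)) (hui _) ?_
            filter_upwards [hν] with y hy
            rw [← hh]
            refine hT.truncLog_normalize hκ hq hqd ?_ (hh ▸ h2.2) (hh ▸ h3.2) hy
            rw [real_inner_eq_re_inner ℂ, hqh]
            simp
          rw [integral_add hi (integrable_const _)] at this
          simpa using this
        have n1 : ‖t • w‖ = t := by rw [norm_smul, hw, Real.norm_of_nonneg ht.le, mul_one]
        have n2 : ‖t • I • w‖ = t := by
          rw [norm_smul, norm_smul, hw, Real.norm_of_nonneg ht.le, norm_I, mul_one, mul_one]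
        have o1 : ⟪q, t • w⟫_ℂ = 0 := by
          rw [← Complex.coe_smul, inner_smul_right, hqw, mul_zero]
        have o2 : ⟪q, t • I • w⟫_ℂ = 0 := by
          rw [← Complex.coe_smul, inner_smul_right, inner_smul_right, hqw, mul_zero, mul_zero]
        have s1 := shift _ o1 n1
        have s2 := shift (-(t • w)) (by rw [inner_neg_right, o1, neg_zero]) (by rw [norm_neg, n1])
        have s3 := shift _ o2 n2
        have s4 := shift (-(t • I • w)) (by rw [inner_neg_right, o2, neg_zero])
          (by rw [norm_neg, n2])
        simp only [← sub_eq_add_neg] at s2 s4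
        have hi : ∀ f : E → E, Continuous f → Integrable (fun y => u (f y)) ν := fun f hf =>
          (huc.comp hf).integrable_of_ae_norm_le hν
        have hsum : ∫ y, complexSecondDiff u (q - y) w t ∂ν =
            ∫ y, u (q - y + t • w) ∂ν + ∫ y, u (q - y - t • w) ∂ν +
            (∫ y, u (q - y + t • I • w) ∂ν + ∫ y, u (q - y - t • I • w) ∂ν) - 4 * Φ q := by
          unfold complexSecondDiff
          rw [integral_sub, integral_add, integral_add, integral_add, integral_const_mul, hΦ1 q hq]
          all_goals first
            | exact hi _ (by fun_prop)
            | exact (hi _ (by fun_prop)).add (hi _ (by fun_prop))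
            | exact (hi _ (by fun_prop)).const_mul _
            | exact ((hi _ (by fun_prop)).add (hi _ (by fun_prop))).add
                ((hi _ (by fun_prop)).add (hi _ (by fun_prop)))
        rw [hsum] at h1
        rw [le_div_iff₀ (by positivity)]
        simp only [complexSecondDiff]
        linarith
      have := ge_of_tendsto (tendsto_complexSecondDiff (hsm q hq0) w) hev
      linarith
    have hw' : 0 < ‖w‖ := norm_pos_iff.2 hw
    have h1 := unit ((‖w‖⁻¹ : ℝ) • w) (by rw [← Complex.coe_smul, inner_smul_right, hqw, mul_zero])
      (by rw [norm_smul, norm_inv, norm_norm, inv_mul_cancel₀ hw'.ne'])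
    rw [smul_comm I] at h1
    simp only [map_smul, smul_apply, smul_eq_mul, ← mul_add] at h1
    have h2 : 0 < ‖w‖⁻¹ := inv_pos.2 hw'
    exact pos_of_mul_pos_right (pos_of_mul_pos_right h1 h2.le) h2.le

end IsLeviFlatCone

end Smoothing

section PosDefSubspace

/-- A real symmetric bilinear form whose average over every complex line is positive is positive
definite on a real subspace of at least half the real dimension. -/
theorem exists_posDef_subspace {W : Type*} [AddCommGroup W] [Module ℂ W] [FiniteDimensional ℂ W]
    (B : W →ₗ[ℝ] W →ₗ[ℝ] ℝ) (hB : ∀ x y, B x y = B y x)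
    (hpos : ∀ w, w ≠ 0 → 0 < B w w + B (I • w) (I • w)) :
    ∃ P : Submodule ℝ W, Module.finrank ℂ W ≤ Module.finrank ℝ P ∧ ∀ e ∈ P, e ≠ 0 → 0 < B e e := by
  have : FiniteDimensional ℝ W := FiniteDimensional.complexToReal W
  let d : Set ℕ := {k | ∃ P : Submodule ℝ W, Module.finrank ℝ P = k ∧ ∀ e ∈ P, e ≠ 0 → 0 < B e e}
  have hd : d.Nonempty := ⟨_, ⊥, rfl, fun e he h0 => absurd ((Submodule.mem_bot ℝ).1 he) h0⟩
  have hbdd : BddAbove d := ⟨Module.finrank ℝ W, by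
    rintro k ⟨P, rfl, -⟩
    exact P.finrank_le⟩
  obtain ⟨P, hPd, hP⟩ := Nat.sSup_mem hd hbdd
  refine ⟨P, ?_, hP⟩
  let f : W →ₗ[ℝ] (P →ₗ[ℝ] ℝ) := (LinearMap.lcomp ℝ ℝ P.subtype).comp B
  have hf : ∀ x (p : P), f x p = B x p := fun x p => rfl
  set N := LinearMap.ker f with hN
  have hNmem : ∀ x, x ∈ N ↔ ∀ p ∈ P, B x p = 0 := by
    intro x
    rw [hN, LinearMap.mem_ker]
    constructor
    · intro h p hp
      exact DFunLike.congr_fun h (⟨p, hp⟩ : P)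
    · intro h
      ext p
      exact h p p.2
  have hneg : ∀ x ∈ N, B x x ≤ 0 := by
    intro x hx
    by_contra! hxx
    have hxP : x ∉ P := by
      intro h
      exact hxx.ne' ((hNmem x).1 hx x h)
    have hx0 : x ≠ 0 := by rintro rfl; exact hxP P.zero_mem
    have hmem : Module.finrank ℝ ↥(P ⊔ ℝ ∙ x) ∈ d := by
      refine ⟨_, rfl, fun e he h0 => ?_⟩
      obtain ⟨p, hp, y, hy, rfl⟩ := Submodule.mem_sup.1 he
      obtain ⟨c, rfl⟩ := Submodule.mem_span_singleton.1 hy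
      have h1 : B x p = 0 := (hNmem x).1 hx p hp
      have h2 : B p x = 0 := by rw [hB, h1]
      have h3 : B (p + c • x) (p + c • x) = B p p + c ^ 2 * B x x := by
        simp only [map_add, map_smul, LinearMap.add_apply, LinearMap.smul_apply, smul_eq_mul, h1,
          h2]
        ring
      rw [h3]
      by_cases hp0 : p = 0
      · have hc : c ≠ 0 := by rintro rfl; simp [hp0] at h0
        rw [hp0]
        simp only [map_zero, zero_add]
        positivity
      · have := hP p hp hp0
        positivity
    have h1 := le_csSup hbdd hmem
    rw [← hPd] at h1
    have h2 : P < P ⊔ ℝ ∙ x := by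
      refine lt_of_le_of_ne le_sup_left fun h => hxP ?_
      rw [h]
      exact Submodule.mem_sup_right (Submodule.mem_span_singleton_self x)
    exact absurd (Submodule.finrank_lt_finrank_of_lt h2) (not_lt.2 h1)
  let J : W ≃ₗ[ℝ] W := (LinearEquiv.smulOfNeZero ℂ W I I_ne_zero).restrictScalars ℝ
  have hJ : ∀ x, J x = I • x := fun x => rfl
  have hdisj : Disjoint N (N.map (J : W →ₗ[ℝ] W)) := by
    rw [Submodule.disjoint_def]
    rintro x hx hx'
    obtain ⟨y, hy, rfl⟩ := Submodule.mem_map.1 hx'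
    by_contra h0
    have hy0 : y ≠ 0 := by rintro rfl; simp at h0
    have h1 := hneg _ hy
    have h2 := hneg _ hx
    have h3 := hpos y hy0
    have : (J : W →ₗ[ℝ] W) y = I • y := rfl
    rw [this] at h2
    linarith
  have h1 : Module.finrank ℝ N + Module.finrank ℝ (N.map (J : W →ₗ[ℝ] W)) ≤ Module.finrank ℝ W :=
    Submodule.finrank_add_finrank_le_of_disjoint hdisj
  have h2 : Module.finrank ℝ (N.map (J : W →ₗ[ℝ] W)) = Module.finrank ℝ N :=
    LinearEquiv.finrank_map_eq J N
  have h3 := LinearMap.finrank_range_add_finrank_ker f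
  have h4 : Module.finrank ℝ (LinearMap.range f) ≤ Module.finrank ℝ P := by
    refine (Submodule.finrank_le _).trans ?_
    exact Subspace.dual_finrank_eq.le
  have h5 : Module.finrank ℝ W = 2 * Module.finrank ℂ W := finrank_real_of_complex W
  rw [← hN] at h3
  omega

end PosDefSubspace

section Pushing

open scoped Topology InnerProductSpace unitInterval
open Filter

/-- A map from the square to a space of dimension at least `3` is approximated by nowhere vanishing
maps. -/
theorem exists_approx_ne_zero {F : Type*} [NormedAddCommGroup F] [NormedSpace ℝ F]
    [FiniteDimensional ℝ F] (hF : 3 ≤ Module.finrank ℝ F) {h : I × I → F} (hh : Continuous h)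
    {η : ℝ} (hη : 0 < η) :
    ∃ h' : I × I → F, Continuous h' ∧ (∀ k, h' k ≠ 0) ∧ ∀ k, ‖h' k - h k‖ ≤ η := by
  have : CompleteSpace F := FiniteDimensional.complete ℝ F
  let H : ℝ × ℝ → F := fun x => h (projIcc 0 1 zero_le_one x.1, projIcc 0 1 zero_le_one x.2)
  have hH : Continuous H :=
    hh.comp ((continuous_projIcc.comp continuous_fst).prodMk
      (continuous_projIcc.comp continuous_snd))
  obtain ⟨G, hG, hGH, -⟩ := hH.exists_contDiff_approx 1 (ε := fun _ => η / 2) continuous_const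
    (fun _ => half_pos hη)
  have hd : Dense (range G)ᶜ :=
    ContDiff.dense_compl_range_of_finrank_lt_finrank (by exact_mod_cast hG) (by
      rw [Module.finrank_prod, Module.finrank_self]; omega)
  obtain ⟨v, hv, hv'⟩ := Metric.dense_iff.1 hd 0 (η / 2) (half_pos hη)
  rw [Metric.mem_ball, dist_zero_right] at hv
  refine ⟨fun k => G (k.1, k.2) - v, ?_, ?_, ?_⟩
  · exact (hG.continuous.comp (by fun_prop)).sub continuous_const
  · intro k hk
    exact hv' ⟨_, sub_eq_zero.1 hk⟩
  · intro k
    have h1 := hGH (k.1, k.2)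
    have h2 : H (k.1, k.2) = h k := by simp [H]
    rw [h2, dist_eq_norm] at h1
    calc ‖G (k.1, k.2) - v - h k‖ = ‖(G (k.1, k.2) - h k) - v‖ := by congr 1; abel
      _ ≤ ‖G (k.1, k.2) - h k‖ + ‖v‖ := norm_sub_le _ _
      _ ≤ η := by linarith

/-- A map from the square to a space of dimension at least `3` which does not vanish on a closed
set can be modified outside this set so as to vanish nowhere. -/
theorem exists_eqOn_ne_zero {F : Type*} [NormedAddCommGroup F] [NormedSpace ℝ F]
    [FiniteDimensional ℝ F] (hF : 3 ≤ Module.finrank ℝ F) {h : I × I → F} (hh : Continuous h)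
    {A : Set (I × I)} (hA : IsClosed A) (h0 : ∀ k ∈ A, h k ≠ 0) :
    ∃ h' : I × I → F, Continuous h' ∧ (∀ k, h' k ≠ 0) ∧ EqOn h' h A := by
  obtain ⟨m, hm, hmA⟩ : ∃ m > 0, ∀ k ∈ A, m ≤ ‖h k‖ :=
    hA.isCompact.exists_forall_le' hh.norm.continuousOn (fun k hk => norm_pos_iff.2 (h0 k hk))
  obtain ⟨p, hp, hp0, hpη⟩ := exists_approx_ne_zero hF hh (show 0 < m / 8 by positivity)
  set χ : I × I → ℝ := fun k => max 0 (min 1 (2 - 2 * ‖h k‖ / m)) with hχ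
  refine ⟨fun k => h k + χ k • (p k - h k), by fun_prop, fun k hk => ?_, fun k hk => ?_⟩
  · rcases le_total ‖h k‖ (m / 2) with hle | hle
    · have : χ k = 1 := by
        have : 1 ≤ 2 - 2 * ‖h k‖ / m := by
          rw [le_sub_comm, div_le_iff₀ hm]
          linarith
        simp [hχ, min_eq_left this]
      simp only [this, one_smul, add_sub_cancel] at hk
      exact hp0 k hk
    · have h1 : 0 ≤ χ k := le_max_left _ _
      have h2 : χ k ≤ 1 := max_le zero_le_one (min_le_left _ _)
      have h3 : ‖χ k • (p k - h k)‖ ≤ m / 8 := by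
        rw [norm_smul, Real.norm_of_nonneg h1]
        nlinarith [hpη k, norm_nonneg (p k - h k)]
      rw [eq_neg_of_add_eq_zero_left hk, norm_neg] at hle
      linarith
  · have : χ k = 0 := by
      have : 2 - 2 * ‖h k‖ / m ≤ 0 := by
        rw [sub_nonpos, le_div_iff₀ hm]
        linarith [hmA k hk]
      exact max_eq_left (min_le_of_right_le this)
    simp [this]

variable {E : Type*} [NormedAddCommGroup E] [InnerProductSpace ℝ E] [FiniteDimensional ℝ E]

/-- Second order lower bound for a function whose Hessian is positive definite on a subspace. -/
theorem exists_quadratic_growth {Φ : E → ℝ} {q₀ : E} (hΦ : ContDiffAt ℝ 2 Φ q₀)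
    {P : Submodule ℝ E} (hP : ∀ e ∈ P, e ≠ 0 → 0 < fderiv ℝ (fderiv ℝ Φ) q₀ e e) :
    ∃ a > 0, ∃ r > 0, ∀ q, ‖q - q₀‖ < r → ∀ e ∈ P, ‖e‖ = 1 → ∀ t, 0 ≤ t → t ≤ r →
      Φ q + t * fderiv ℝ Φ q e + a * t ^ 2 ≤ Φ (q + t • e) := by
  have : ProperSpace E := FiniteDimensional.proper ℝ E
  obtain ⟨a, ha, haP⟩ : ∃ a > 0, ∀ e ∈ Metric.sphere (0 : E) 1 ∩ P,
      a ≤ fderiv ℝ (fderiv ℝ Φ) q₀ e e := by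
    refine ((isCompact_sphere 0 1).inter_right P.closed_of_finiteDimensional).exists_forall_le'
      (by fun_prop) fun e he => hP e he.2 ?_
    rintro rfl
    simpa using he.1
  have h1 : ContDiffAt ℝ 1 (fderiv ℝ Φ) q₀ := hΦ.fderiv_right (by norm_num)
  have h2 : ContinuousAt (fderiv ℝ (fderiv ℝ Φ)) q₀ :=
    (h1.fderiv_right (m := 0) (by norm_num)).continuousAt
  have h3 : ∀ᶠ x in 𝓝 q₀, ContDiffAt ℝ 2 Φ x := hΦ.eventually (by simp)
  have h4 : ∀ᶠ x in 𝓝 q₀, ‖fderiv ℝ (fderiv ℝ Φ) x - fderiv ℝ (fderiv ℝ Φ) q₀‖ < a / 2 := by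
    have h5 := (tendsto_iff_norm_sub_tendsto_zero (E := E →L[ℝ] E →L[ℝ] ℝ)
      (f := fderiv ℝ (fderiv ℝ Φ)) (b := fderiv ℝ (fderiv ℝ Φ) q₀)).1 h2
    exact h5.eventually_lt_const (half_pos ha)
  obtain ⟨r, hr, hball⟩ := Metric.eventually_nhds_iff.1 (h3.and h4)
  refine ⟨a / 4, by positivity, r / 2, by positivity, fun q hq e he he1 t ht0 ht => ?_⟩
  have hx : ∀ s ∈ Icc 0 t, dist (q + s • e) q₀ < r := by
    intro s hs
    rw [dist_eq_norm]
    have : ‖q - q₀ + s • e‖ ≤ ‖q - q₀‖ + s := by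
      refine (norm_add_le _ _).trans ?_
      rw [norm_smul, he1, Real.norm_of_nonneg hs.1, mul_one]
    rw [add_sub_right_comm]
    linarith [hs.2]
  have hline : ∀ s : ℝ, HasDerivAt (fun s : ℝ => q + s • e) e s := fun s => by
    simpa using ((hasDerivAt_id s).smul_const e).const_add q
  have hd1 : ∀ s ∈ Icc 0 t, HasDerivAt (fun s => Φ (q + s • e)) (fderiv ℝ Φ (q + s • e) e) s := by
    intro s hs
    have := ((hball (hx s hs)).1.differentiableAt (by norm_num)).hasFDerivAt
    exact this.comp_hasDerivAt s (hline s)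
  have hd2 : ∀ s ∈ Icc 0 t, HasDerivAt (fun s => fderiv ℝ Φ (q + s • e) e)
      (fderiv ℝ (fderiv ℝ Φ) (q + s • e) e e) s := by
    intro s hs
    have h5 : ContDiffAt ℝ 1 (fderiv ℝ Φ) (q + s • e) :=
      (hball (hx s hs)).1.fderiv_right (by norm_num)
    have h6 := (h5.differentiableAt (by norm_num)).hasFDerivAt.comp_hasDerivAt s (hline s)
    exact ((ContinuousLinearMap.apply ℝ ℝ e).hasFDerivAt.comp_hasDerivAt s h6)
  have hlow : ∀ s ∈ Icc 0 t, a / 2 ≤ fderiv ℝ (fderiv ℝ Φ) (q + s • e) e e := by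
    intro s hs
    have h5 := (hball (hx s hs)).2
    have h6 := haP e ⟨by simpa using he1, he⟩
    have h7 := (fderiv ℝ (fderiv ℝ Φ) (q + s • e) - fderiv ℝ (fderiv ℝ Φ) q₀).le_opNorm₂ e e
    rw [he1, mul_one, mul_one] at h7
    have h8 := (abs_le.1 (h7.trans h5.le)).1
    simp only [sub_apply] at h8
    linarith
  have mono1 : MonotoneOn (fun s => fderiv ℝ Φ (q + s • e) e - a / 2 * s) (Icc 0 t) := by
    refine monotoneOn_of_hasDerivWithinAt_nonneg (convex_Icc 0 t)
      (f' := fun s => fderiv ℝ (fderiv ℝ Φ) (q + s • e) e e - a / 2 * 1) ?_ ?_ ?_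
    · intro s hs
      exact ((hd2 s hs).continuousAt.sub (by fun_prop)).continuousWithinAt
    · intro s hs
      exact ((hd2 s (interior_subset hs)).sub
        ((hasDerivAt_id s).const_mul (a / 2))).hasDerivWithinAt
    · intro s hs
      linarith [hlow s (interior_subset hs)]
  have mono2 : MonotoneOn (fun s => Φ (q + s • e) - s * fderiv ℝ Φ q e - a / 4 * s ^ 2)
      (Icc 0 t) := by
    refine monotoneOn_of_hasDerivWithinAt_nonneg (convex_Icc 0 t)
      (f' := fun s => fderiv ℝ Φ (q + s • e) e - 1 * fderiv ℝ Φ q e - a / 4 * (2 * s)) ?_ ?_ ?_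
    · intro s hs
      exact (((hd1 s hs).continuousAt.sub (by fun_prop)).sub (by fun_prop)).continuousWithinAt
    · intro s hs
      refine (((hd1 s (interior_subset hs)).sub ((hasDerivAt_id s).mul_const _)).sub
        (HasDerivAt.const_mul (a / 4) ?_)).hasDerivWithinAt
      simpa using hasDerivAt_pow 2 s
    · intro s hs
      have hs' := interior_subset hs
      have := mono1 (left_mem_Icc.2 ht0) hs' hs'.1
      simp at this
      linarith
  have := mono2 (left_mem_Icc.2 ht0) (right_mem_Icc.2 ht0) ht0
  simp at this
  linarith

end Pushing

section PushingCompact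

set_option linter.unusedSectionVars false
open scoped Topology InnerProductSpace unitInterval
open Filter

variable {E : Type*} [NormedAddCommGroup E] [InnerProductSpace ℝ E] [FiniteDimensional ℝ E]

/-- Maps from the square to the unit sphere can be pushed away from `C` by increasing `Φ`,
without moving the points at which `c ≤ Φ`. -/
def Pushable (Φ : E → ℝ) (c : ℝ) (C : Set E) : Prop :=
  ∃ δ > 0, ∃ a > 0, ∀ ε > 0, ∀ g : I × I → E, Continuous g → (∀ k, ‖g k‖ = 1) →
    ∃ g' : I × I → E, Continuous g' ∧ (∀ k, ‖g' k‖ = 1) ∧ (∀ k, c ≤ Φ (g k) → g' k = g k) ∧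
      (∀ k, Φ (g k) + a * ‖g' k - g k‖ ^ 2 - ε ≤ Φ (g' k)) ∧
      ∀ k, ∀ x ∈ C, ‖g k - x‖ < δ → Φ (g k) + δ ≤ Φ (g' k)

theorem Pushable.mono {Φ : E → ℝ} {c : ℝ} {C D : Set E} (h : Pushable Φ c D) (hCD : C ⊆ D) :
    Pushable Φ c C := by
  obtain ⟨δ, hδ, a, ha, H⟩ := h
  refine ⟨δ, hδ, a, ha, fun ε hε g hg hg1 => ?_⟩
  obtain ⟨g', h1, h2, h3, h4, h5⟩ := H ε hε g hg hg1
  exact ⟨g', h1, h2, h3, h4, fun k x hx => h5 k x (hCD hx)⟩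

theorem Pushable.empty (Φ : E → ℝ) (c : ℝ) : Pushable Φ c ∅ :=
  ⟨1, one_pos, 1, one_pos, fun ε hε g hg hg1 =>
    ⟨g, hg, hg1, fun _ _ => rfl, fun k => by simp [hε.le], fun _ _ hx => hx.elim⟩⟩

theorem Pushable.union {Φ : E → ℝ} {c : ℝ} {C D : Set E} (hC : Pushable Φ c C)
    (hD : Pushable Φ c D) : Pushable Φ c (C ∪ D) := by
  obtain ⟨δ₁, hδ₁, a₁, ha₁, H₁⟩ := hC
  obtain ⟨δ₂, hδ₂, a₂, ha₂, H₂⟩ := hD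
  have hb : 0 < a₁ * δ₂ ^ 2 := by positivity
  refine ⟨min (min (δ₁ / 2) (δ₂ / 2)) (a₁ * δ₂ ^ 2 / 8), by positivity, min a₁ a₂ / 2,
    by positivity, fun ε hε g hg hg1 => ?_⟩
  obtain ⟨ε', hε', e1, e2, e3, e4⟩ : ∃ ε' > 0, ε' ≤ ε / 2 ∧ ε' ≤ δ₁ / 2 ∧ ε' ≤ δ₂ / 4 ∧
      ε' ≤ a₁ * δ₂ ^ 2 / 16 := by
    refine ⟨min (min (ε / 2) (δ₁ / 2)) (min (δ₂ / 4) (a₁ * δ₂ ^ 2 / 16)), by positivity,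
      ?_, ?_, ?_, ?_⟩ <;> simp
  obtain ⟨f, hf, hf1, hfc, hfa, hfδ⟩ := H₁ ε' hε' g hg hg1
  obtain ⟨f', hf', hf1', hfc', hfa', hfδ'⟩ := H₂ ε' hε' f hf hf1
  refine ⟨f', hf', hf1', fun k hk => ?_, fun k => ?_, fun k x hx hxk => ?_⟩
  · have := hfc k hk
    rw [hfc' k (this ▸ hk), this]
  · have h1 := hfa k
    have h2 := hfa' k
    have h3 : ‖f' k - g k‖ ≤ ‖f' k - f k‖ + ‖f k - g k‖ := norm_sub_le_norm_sub_add_norm_sub ..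
    have h4 : ‖f' k - g k‖ ^ 2 ≤ 2 * ‖f' k - f k‖ ^ 2 + 2 * ‖f k - g k‖ ^ 2 := by
      nlinarith [norm_nonneg (f' k - g k), sq_nonneg (‖f' k - f k‖ - ‖f k - g k‖)]
    have h5 : min a₁ a₂ / 2 * ‖f' k - g k‖ ^ 2 ≤
        a₂ * ‖f' k - f k‖ ^ 2 + a₁ * ‖f k - g k‖ ^ 2 := by
      have h6 : 0 < min a₁ a₂ := lt_min ha₁ ha₂
      have h7 := mul_le_mul_of_nonneg_right (min_le_left a₁ a₂) (sq_nonneg ‖f k - g k‖)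
      have h8 := mul_le_mul_of_nonneg_right (min_le_right a₁ a₂) (sq_nonneg ‖f' k - f k‖)
      nlinarith
    linarith
  · have d1 : min (min (δ₁ / 2) (δ₂ / 2)) (a₁ * δ₂ ^ 2 / 8) ≤ δ₁ / 2 := by simp
    have d2 : min (min (δ₁ / 2) (δ₂ / 2)) (a₁ * δ₂ ^ 2 / 8) ≤ δ₂ / 2 := by simp
    have d3 : min (min (δ₁ / 2) (δ₂ / 2)) (a₁ * δ₂ ^ 2 / 8) ≤ a₁ * δ₂ ^ 2 / 8 := by simp
    have h1 := hfa k
    have h2 := hfa' k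
    have h3 : 0 ≤ a₂ * ‖f' k - f k‖ ^ 2 := by positivity
    have h4 : 0 ≤ a₁ * ‖f k - g k‖ ^ 2 := by positivity
    rcases hx with hx | hx
    · have := hfδ k x hx (by linarith)
      linarith
    · rcases lt_or_ge ‖f k - g k‖ (δ₂ / 2) with hlt | hge
      · have h5 : ‖f k - x‖ ≤ ‖f k - g k‖ + ‖g k - x‖ := norm_sub_le_norm_sub_add_norm_sub ..
        have := hfδ' k x hx (by linarith)
        linarith
      · have h5 : a₁ * (δ₂ / 2) ^ 2 ≤ a₁ * ‖f k - g k‖ ^ 2 := by gcongr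
        nlinarith

theorem norm_normalize_sub_le {q e : E} (hq : ‖q‖ = 1) (he : ‖e‖ = 1) {t : ℝ} (ht : 0 ≤ t) :
    ‖‖q + t • e‖⁻¹ • (q + t • e) - q‖ ≤ 2 * t := by
  set x := q + t • e with hx
  have h0 : ‖x - q‖ = t := by rw [hx, add_sub_cancel_left, norm_smul, he, mul_one,
    Real.norm_of_nonneg ht]
  rcases eq_or_ne x 0 with h | h
  · have : t = 1 := by rw [← h0, h, zero_sub, norm_neg, hq]
    rw [h, smul_zero, zero_sub, norm_neg, hq]
    linarith
  · have h1 : ‖‖x‖⁻¹ • x - x‖ = |1 - ‖x‖| := by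
      have : ‖x‖⁻¹ • x - x = (‖x‖⁻¹ - 1) • x := by rw [sub_smul, one_smul]
      rw [this, norm_smul, Real.norm_eq_abs]
      nth_rewrite 2 [← abs_norm x]
      rw [← abs_mul, sub_mul, one_mul, inv_mul_cancel₀ (norm_ne_zero_iff.2 h)]
    have h2 : |1 - ‖x‖| ≤ t := by
      rw [← h0, ← hq, norm_sub_rev]
      exact abs_norm_sub_norm_le q x
    calc _ ≤ ‖‖x‖⁻¹ • x - x‖ + ‖x - q‖ := norm_sub_le_norm_sub_add_norm_sub ..
      _ ≤ 2 * t := by linarith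

theorem Pushable.ball {Φ : E → ℝ} (hΦ : ∀ x ≠ 0, ContDiffAt ℝ 2 Φ x)
    (hN : ∀ x ≠ 0, Φ (‖x‖⁻¹ • x) = Φ x) {c : ℝ} {q₀ : E} (hq₀ : ‖q₀‖ = 1) (hc : Φ q₀ < c)
    {P : Submodule ℝ E} (hP3 : 3 ≤ Module.finrank ℝ P)
    (hP : ∀ e ∈ P, e ≠ 0 → 0 < fderiv ℝ (fderiv ℝ Φ) q₀ e e) :
    ∃ R > 0, Pushable Φ c (Metric.ball q₀ R) := by
  have hq0 : q₀ ≠ 0 := by rintro rfl; simp at hq₀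
  obtain ⟨a, ha, r, hr, hgrow⟩ := exists_quadratic_growth (hΦ q₀ hq0) hP
  obtain ⟨r₂, hr₂, hball⟩ := Metric.eventually_nhds_iff.1
    ((hΦ q₀ hq0).continuousAt.eventually_lt_const hc)
  obtain ⟨R, hR, hRr, hRr₂, hR1⟩ : ∃ R > 0, R ≤ r ∧ R ≤ r₂ ∧ R ≤ 1 / 2 :=
    ⟨min r (min r₂ (1 / 2)), by positivity, by simp, by simp, by simp⟩
  refine ⟨R / 8, by positivity, min (R / 8) (a * R ^ 2 / 32), by positivity, a / 4, by positivity,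
    fun ε hε g hg hg1 => ?_⟩
  have hg0 : ∀ k, g k ≠ 0 := fun k => norm_ne_zero_iff.1 (by rw [hg1]; exact one_ne_zero)
  let h : I × I → P := fun k =>
    (InnerProductSpace.toDual ℝ P).symm ((fderiv ℝ Φ (g k)).comp P.subtypeL)
  have hh : Continuous h := by
    refine (InnerProductSpace.toDual ℝ P).symm.continuous.comp ?_
    have : Continuous fun k => fderiv ℝ Φ (g k) := by
      refine continuous_iff_continuousAt.2 fun k => ?_
      have h1 : ContinuousAt (fderiv ℝ Φ) (g k) :=
        ((hΦ _ (hg0 k)).fderiv_right (m := 1) (by norm_num)).continuousAt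
      exact ContinuousAt.comp (f := g) h1 hg.continuousAt
    fun_prop
  have hinner : ∀ k (e : P), ⟪h k, e⟫_ℝ = fderiv ℝ Φ (g k) e := fun k e => by
    simp [h, InnerProductSpace.toDual_symm_apply]
  set η := min (ε / R) (a * R / 8) with hη
  have hη0 : 0 < η := by positivity
  obtain ⟨h', hh', h0', hη'⟩ := exists_approx_ne_zero hP3 hh hη0
  let e : I × I → P := fun k => ‖h' k‖⁻¹ • h' k
  have he : Continuous e := (hh'.norm.inv₀ fun k => norm_ne_zero_iff.2 (h0' k)).smul hh'
  have he1 : ∀ k, ‖(e k : E)‖ = 1 := fun k => by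
    have : ‖e k‖ = 1 := norm_smul_inv_norm (𝕜 := ℝ) (h0' k)
    exact this
  have hde : ∀ k, -η ≤ fderiv ℝ Φ (g k) (e k) := fun k => by
    have h1 : ⟪h' k, e k⟫_ℝ = ‖h' k‖ := by
      rw [inner_smul_right, real_inner_self_eq_norm_sq]
      field_simp [norm_ne_zero_iff.2 (h0' k)]
    have h2 : |⟪h' k - h k, e k⟫_ℝ| ≤ η := by
      refine (abs_real_inner_le_norm _ _).trans ?_
      have : ‖e k‖ = 1 := he1 k
      rw [this, mul_one]
      exact hη' k
    rw [inner_sub_left, h1, hinner] at h2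
    linarith [(abs_le.1 h2).2, norm_nonneg (h' k)]
  let τ : I × I → ℝ := fun k => max 0 (R / 2 - ‖g k - q₀‖)
  have hτ0 : ∀ k, 0 ≤ τ k := fun k => le_max_left _ _
  have hτR : ∀ k, τ k ≤ R / 2 := fun k =>
    max_le (by positivity) (by linarith [norm_nonneg (g k - q₀)])
  have hgain : ∀ k, Φ (g k) + (a * τ k ^ 2 - τ k * η) ≤ Φ (g k + τ k • (e k : E)) := fun k => by
    rcases lt_or_ge ‖g k - q₀‖ r with hlt | hge
    · have h1 := hgrow (g k) hlt (e k) (e k).2 (he1 k) (τ k) (hτ0 k) (by linarith [hτR k])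
      have h2 := mul_le_mul_of_nonneg_left (hde k) (hτ0 k)
      linarith
    · have : τ k = 0 := max_eq_left (by linarith)
      simp [this]
  have hx0 : ∀ k, g k + τ k • (e k : E) ≠ 0 := fun k hk => by
    have h1 := congrArg norm (eq_neg_of_add_eq_zero_left hk)
    rw [hg1, norm_neg, norm_smul, he1, Real.norm_of_nonneg (hτ0 k)] at h1
    linarith [hτR k]
  have hx : Continuous fun k => g k + τ k • (e k : E) := by fun_prop
  refine ⟨fun k => ‖g k + τ k • (e k : E)‖⁻¹ • (g k + τ k • (e k : E)),
    (hx.norm.inv₀ fun k => norm_ne_zero_iff.2 (hx0 k)).smul hx,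
    fun k => norm_smul_inv_norm (𝕜 := ℝ) (hx0 k), fun k hk => ?_, fun k => ?_,
    fun k x hxq hxk => ?_⟩
  · have h1 : R ≤ ‖g k - q₀‖ := by
      by_contra! hlt
      exact absurd (hball (y := g k) (by rw [dist_eq_norm]; linarith)) (not_lt.2 hk)
    have : τ k = 0 := max_eq_left (by linarith)
    simp [this, hg1]
  · rw [hN _ (hx0 k)]
    have h1 := norm_normalize_sub_le (hg1 k) (he1 k) (hτ0 k)
    have h2 : τ k * η ≤ ε := by
      calc τ k * η ≤ R * (ε / R) := by
            gcongr
            · linarith [hτR k]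
            · exact min_le_left _ _
        _ = ε := by field_simp
    have h3 := pow_le_pow_left₀ (norm_nonneg _) h1 2
    have h4 := mul_le_mul_of_nonneg_left h3 (show 0 ≤ a / 4 by positivity)
    linarith [hgain k]
  · rw [hN _ (hx0 k)]
    have h1 : ‖g k - q₀‖ ≤ ‖g k - x‖ + ‖x - q₀‖ := norm_sub_le_norm_sub_add_norm_sub ..
    rw [Metric.mem_ball, dist_eq_norm] at hxq
    have h2 : R / 4 ≤ τ k := by
      have := min_le_left (R / 8) (a * R ^ 2 / 32)
      exact le_max_of_le_right (by linarith)
    have h3 : η ≤ a * R / 8 := min_le_right _ _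
    have h4 : a * R / 8 ≤ a * τ k - η := by nlinarith
    have h5 : R / 4 * (a * R / 8) ≤ τ k * (a * τ k - η) := by gcongr
    have := min_le_right (R / 8) (a * R ^ 2 / 32)
    nlinarith [hgain k]

/-- Pushing maps from the square to the unit sphere into a superlevel set of `Φ`. -/
theorem exists_push {Φ : E → ℝ} (hΦ : ∀ x ≠ 0, ContDiffAt ℝ 2 Φ x)
    (hN : ∀ x ≠ 0, Φ (‖x‖⁻¹ • x) = Φ x) {c₀ c : ℝ} (hc : c₀ < c)
    (hP : ∀ q, ‖q‖ = 1 → Φ q < c → ∃ P : Submodule ℝ E, 3 ≤ Module.finrank ℝ P ∧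
      ∀ e ∈ P, e ≠ 0 → 0 < fderiv ℝ (fderiv ℝ Φ) q e e)
    {g : I × I → E} (hg : Continuous g) (hg1 : ∀ k, ‖g k‖ = 1) :
    ∃ g' : I × I → E, Continuous g' ∧ (∀ k, ‖g' k‖ = 1) ∧ (∀ k, c ≤ Φ (g k) → g' k = g k) ∧
      ∀ k, c₀ < Φ (g' k) := by
  have : ProperSpace E := FiniteDimensional.proper ℝ E
  have hΦc : ContinuousOn Φ (Metric.sphere 0 1) := fun x hx =>
    (hΦ x (by rintro rfl; simp at hx)).continuousAt.continuousWithinAt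
  set c₁ := (c₀ + c) / 2 with hc₁
  have hZ : IsCompact (Metric.sphere (0 : E) 1 ∩ Φ ⁻¹' Iic c₁) :=
    (isCompact_sphere (0 : E) 1).of_isClosed_subset
      (hΦc.preimage_isClosed_of_isClosed Metric.isClosed_sphere isClosed_Iic) inter_subset_left
  have hpush : Pushable Φ c (Metric.sphere (0 : E) 1 ∩ Φ ⁻¹' Iic c₁) := by
    refine hZ.induction_on (.empty Φ c) (fun _ _ hst ht => ht.mono hst)
      (fun _ _ => Pushable.union) fun q hq => ?_
    have hq1 : ‖q‖ = 1 := by simpa using hq.1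
    have hq2 : Φ q < c := lt_of_le_of_lt hq.2 (by rw [hc₁]; linarith)
    obtain ⟨P, hP3, hPp⟩ := hP q hq1 hq2
    obtain ⟨R, hR, hRp⟩ := Pushable.ball hΦ hN hq1 hq2 hP3 hPp
    exact ⟨_, mem_nhdsWithin_of_mem_nhds (Metric.ball_mem_nhds q hR), hRp⟩
  obtain ⟨δ, hδ, a, ha, H⟩ := hpush
  obtain ⟨L, hL⟩ : ∃ L, ∀ k, L ≤ Φ (g k) := by
    obtain ⟨L, hL⟩ := ((isCompact_sphere (0 : E) 1).image_of_continuousOn hΦc).bddBelow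
    exact ⟨L, fun k => hL ⟨g k, by simpa using hg1 k, rfl⟩⟩
  have hiter : ∀ m : ℕ, ∃ g' : I × I → E, Continuous g' ∧ (∀ k, ‖g' k‖ = 1) ∧
      (∀ k, c ≤ Φ (g k) → g' k = g k) ∧
      ∀ k, min (c₁ - (c₁ - c₀) / 2) (L + m * δ) ≤ Φ (g' k) := by
    intro m
    induction m with
    | zero => exact ⟨g, hg, hg1, fun _ _ => rfl, fun k => by simp [hL k]⟩
    | succ m ih =>
      obtain ⟨f, hf, hf1, hfc, hfm⟩ := ih
      obtain ⟨f', hf', hf1', hfc', hfa', hfδ'⟩ :=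
        H ((c₁ - c₀) / 2) (by rw [hc₁]; linarith) f hf hf1
      refine ⟨f', hf', hf1', fun k hk => ?_, fun k => ?_⟩
      · have := hfc k hk
        rw [hfc' k (this ▸ hk), this]
      · rcases le_or_gt (Φ (f k)) c₁ with hle | hgt
        · have h1 := hfδ' k (f k) ⟨by simpa using hf1 k, hle⟩ (by simpa using hδ)
          have h2 := hfm k
          push_cast
          rcases min_le_iff.1 h2 with h3 | h3
          · exact min_le_of_left_le (by linarith)
          · exact min_le_of_right_le (by linarith)
        · have h1 := hfa' k
          have : 0 ≤ a * ‖f' k - f k‖ ^ 2 := by positivity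
          exact min_le_of_left_le (by linarith)
  obtain ⟨m, hm⟩ := exists_nat_gt ((c₁ - L) / δ)
  obtain ⟨g', h1, h2, h3, h4⟩ := hiter m
  refine ⟨g', h1, h2, h3, fun k => lt_of_lt_of_le ?_ (h4 k)⟩
  rw [div_lt_iff₀ hδ] at hm
  exact lt_min (by rw [hc₁]; linarith) (by rw [hc₁] at hm; linarith)

end PushingCompact

section Retraction

open scoped Topology InnerProductSpace
open Filter

attribute [local instance] InnerProductSpace.complexToReal

variable {E : Type*} [NormedAddCommGroup E] [InnerProductSpace ℂ E] [FiniteDimensional ℂ E]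

/-- Nearest points are unique near a `C²` hypersurface. -/
theorem IsLeviFlatCone.exists_forall_nearest_unique {T : Set E} (hT : IsLeviFlatCone T) {p : E}
    (hp : p ∈ T) : ∃ r > 0, ∀ q, ‖q - p‖ < r → ∀ m ∈ T, ∀ m' ∈ T, coneDist T q = ‖q - m‖ →
      coneDist T q = ‖q - m'‖ → m = m' := by
  obtain ⟨V, ρ, hpV, hρ, -⟩ := hT.exists_defining p hp
  have h1 : ContDiffAt ℝ 1 (fderiv ℝ ρ) p := (hρ.contDiffAt hpV).fderiv_right (by norm_num)
  obtain ⟨K, t, ht, hK⟩ := h1.exists_lipschitzOnWith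
  have hc : 0 < ‖fderiv ℝ ρ p‖ := norm_pos_iff.2 (hρ.fderiv_ne_zero p hpV)
  set c := ‖fderiv ℝ ρ p‖ / 2 with hc'
  have h2 : ∀ᶠ m in 𝓝 p, c < ‖fderiv ℝ ρ m‖ :=
    h1.continuousAt.norm.eventually_const_lt (by linarith)
  obtain ⟨s, hs, hball⟩ := Metric.eventually_nhds_iff_ball.1
    (h2.and ((hρ.isOpen.eventually_mem hpV).and ht))
  have hc0 : 0 < c := by linarith
  refine ⟨min (s / 2) (c / (4 * (K + 1))), by positivity, fun q hq m hm m' hm' hqm hqm' => ?_⟩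
  have hq1 : ‖q - p‖ < s / 2 := hq.trans_le (min_le_left _ _)
  have hq2 : ‖q - p‖ < c / (4 * (K + 1)) := hq.trans_le (min_le_right _ _)
  have hmem : ∀ x ∈ T, coneDist T q = ‖q - x‖ → x ∈ Metric.ball p s := by
    intro x _ hx
    have h3 := coneDist_le_dist hp q
    have h4 : ‖x - p‖ ≤ ‖x - q‖ + ‖q - p‖ := norm_sub_le_norm_sub_add_norm_sub ..
    rw [norm_sub_rev x q] at h4
    rw [Metric.mem_ball, dist_eq_norm]
    linarith
  have hms := hmem m hm hqm
  have hms' := hmem m' hm' hqm'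
  obtain ⟨hcm, hmV, hmt⟩ := hball m hms
  obtain ⟨-, hmV', hmt'⟩ := hball m' hms'
  obtain ⟨μ, hμ⟩ := hρ.exists_multiplier_nearest hm hmV hqm
  have hsub : segment ℝ m m' ⊆ Metric.ball p s := (convex_ball p s).segment_subset hms hms'
  have hquad : |fderiv ℝ ρ m (m' - m)| ≤ K * ‖m' - m‖ * ‖m' - m‖ := by
    have h5 := Convex.norm_image_sub_le_of_norm_hasFDerivWithin_le' (𝕜 := ℝ) (f := ρ)
      (f' := fderiv ℝ ρ) (φ := fderiv ℝ ρ m) (C := K * ‖m' - m‖) (s := segment ℝ m m')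
      (x := m) (y := m')
      (fun x hx => ((hρ.contDiffAt (hball x (hsub hx)).2.1).differentiableAt
        (by norm_num)).hasFDerivAt.hasFDerivWithinAt)
      (fun x hx => by
        refine (hK.norm_sub_le (hball x (hsub hx)).2.2 hmt).trans ?_
        gcongr
        rw [← dist_eq_norm, ← dist_eq_norm]
        obtain ⟨θ, hθ, rfl⟩ := (segment_eq_image_lineMap ℝ m m') ▸ hx
        rw [dist_lineMap_left, dist_comm m m', Real.norm_of_nonneg hθ.1]
        exact mul_le_of_le_one_left dist_nonneg hθ.2)
      (convex_segment m m') (left_mem_segment ℝ m m') (right_mem_segment ℝ m m')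
    rwa [(hρ.mem_iff m' hmV').1 hm', (hρ.mem_iff m hmV).1 hm, sub_zero, zero_sub, norm_neg] at h5
  have hμc : |μ| * c ≤ ‖q - p‖ := by
    have h6 : innerSL ℝ (q - m) = μ • fderiv ℝ ρ m := by
      ext x
      rw [innerSL_apply_apply, hμ]
      rfl
    have h7 := congrArg norm h6
    rw [innerSL_apply_norm, norm_smul, Real.norm_eq_abs] at h7
    have h8 := coneDist_le_dist hp q
    rw [hqm, h7] at h8
    exact (mul_le_mul_of_nonneg_left hcm.le (abs_nonneg μ)).trans h8
  have hexp : ‖m' - m‖ ^ 2 = 2 * ⟪q - m, m' - m⟫_ℝ := by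
    have h9 := norm_sub_sq_real (q - m) (m' - m)
    rw [sub_sub_sub_cancel_right, ← hqm', ← hqm] at h9
    linarith
  have hle : ‖m' - m‖ ^ 2 ≤ 2 * (|μ| * K) * ‖m' - m‖ ^ 2 := by
    nth_rewrite 1 [hexp]
    rw [hμ]
    have h10 : μ * fderiv ℝ ρ m (m' - m) ≤ |μ| * |fderiv ℝ ρ m (m' - m)| := by
      rw [← abs_mul]
      exact le_abs_self _
    have h11 := mul_le_mul_of_nonneg_left hquad (abs_nonneg μ)
    nlinarith
  have hsmall : 2 * (|μ| * K) < 1 := by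
    have hK0 : (0 : ℝ) ≤ K := K.2
    rw [lt_div_iff₀ (by positivity)] at hq2
    have h12 : |μ| * c * (4 * (K + 1)) < c := lt_of_le_of_lt (by gcongr) hq2
    have h13 : |μ| * (4 * (K + 1)) < 1 := by
      by_contra! hcon
      nlinarith
    nlinarith [abs_nonneg μ]
  have h14 : ‖m' - m‖ ^ 2 = 0 := by nlinarith [sq_nonneg ‖m' - m‖]
  exact (sub_eq_zero.1 (norm_eq_zero.1 (pow_eq_zero_iff two_ne_zero |>.1 h14))).symm

/-- A retraction onto `T`, continuous at the unit vectors close to `T`. -/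
theorem IsLeviFlatCone.exists_retraction {T : Set E} (hT : IsLeviFlatCone T) :
    ∃ ε > 0, ∃ R : E → E, (∀ q, ‖q‖ = 1 → R q ∈ T) ∧ (∀ q ∈ T, R q = q) ∧
      ∀ q, ‖q‖ = 1 → coneDist T q < ε → ContinuousAt R q := by
  have : ProperSpace E := FiniteDimensional.proper ℂ E
  choose! R hRT hR using fun q (hq : q ≠ 0) => hT.exists_nearest hq
  choose! r hr hru using fun p (hp : p ∈ T) => hT.exists_forall_nearest_unique hp
  set O : Set E := ⋃ p ∈ T, Metric.ball p (r p) with hO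
  have hOo : IsOpen O := isOpen_biUnion fun _ _ => Metric.isOpen_ball
  have hTO : T ⊆ O := fun p hp => mem_biUnion hp (Metric.mem_ball_self (hr p hp))
  have hunique : ∀ q ∈ O, ∀ m ∈ T, ∀ m' ∈ T, coneDist T q = ‖q - m‖ →
      coneDist T q = ‖q - m'‖ → m = m' := by
    intro q hq
    obtain ⟨p, hp, hqp⟩ := mem_iUnion₂.1 hq
    exact hru p hp q (by rwa [Metric.mem_ball, dist_eq_norm] at hqp)
  have hne : ∀ q : E, ‖q‖ = 1 → q ≠ 0 := fun q hq =>
    norm_ne_zero_iff.1 (by rw [hq]; exact one_ne_zero)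
  obtain ⟨ε, hε, hεO⟩ : ∃ ε > 0, ∀ q ∈ Metric.sphere (0 : E) 1 \ O, ε ≤ coneDist T q := by
    refine ((isCompact_sphere 0 1).diff hOo).exists_forall_le' (continuous_coneDist T).continuousOn
      fun q hq => (coneDist_nonneg T q).lt_of_ne' fun h0 => ?_
    exact hq.2 (hTO (hT.mem_of_coneDist_eq_zero (hne q (by simpa using hq.1)) h0))
  refine ⟨ε, hε, R, fun q hq => hRT q (hne q hq), fun q hq => ?_, fun q₀ hq₀ hlt => ?_⟩
  · have h1 := hR q fun h0 => hT.zero_notMem (h0 ▸ hq)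
    rw [coneDist_eq_zero_of_mem hq, eq_comm, norm_eq_zero, sub_eq_zero] at h1
    exact h1.symm
  · have hq0 : q₀ ≠ 0 := hne q₀ hq₀
    have hqO : q₀ ∈ O := by
      by_contra hn
      exact absurd (hεO q₀ ⟨by simpa using hq₀, hn⟩) (not_le.2 hlt)
    have hev : ∀ᶠ q in 𝓝 q₀, q ≠ 0 ∧ ‖q - q₀‖ < 1 :=
      (eventually_ne_nhds hq0).and (by
        filter_upwards [Metric.ball_mem_nhds q₀ one_pos] with q hq
        rwa [Metric.mem_ball, dist_eq_norm] at hq)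
    refine (isCompact_closedBall q₀ 3).tendsto_nhds_of_unique_mapClusterPt ?_ ?_
    · filter_upwards [hev] with q hq
      have h1 := hR q hq.1
      have h2 := coneDist_le_norm T q
      have h3 : ‖q‖ ≤ ‖q - q₀‖ + ‖q₀‖ := by simpa using norm_add_le (q - q₀) q₀
      have h4 : ‖R q - q₀‖ ≤ ‖R q - q‖ + ‖q - q₀‖ := norm_sub_le_norm_sub_add_norm_sub ..
      rw [norm_sub_rev (R q) q] at h4
      rw [Metric.mem_closedBall, dist_eq_norm]
      linarith [hq.2]
    · intro y _ hy
      have hyT : y ∈ insert 0 T := by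
        refine isClosed_iff_clusterPt.1 hT.isClosed y (ClusterPt.mono hy ?_)
        rw [le_principal_iff, mem_map]
        filter_upwards [hev] with q hq
        exact mem_insert_of_mem _ (hRT q hq.1)
      have hcl : MapClusterPt ‖q₀ - y‖ (𝓝 q₀) ((fun x => ‖q₀ - x‖) ∘ R) :=
        MapClusterPt.continuousAt_comp (f := fun x => ‖q₀ - x‖) (by fun_prop) hy
      have htend : Tendsto ((fun x => ‖q₀ - x‖) ∘ R) (𝓝 q₀) (𝓝 (coneDist T q₀)) := by
        have h1 : Tendsto (fun q => ‖q - q₀‖) (𝓝 q₀) (𝓝 0) := by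
          have : ContinuousAt (fun q => ‖q - q₀‖) q₀ := by fun_prop
          simpa [ContinuousAt] using this
        have h2 : Tendsto (coneDist T) (𝓝 q₀) (𝓝 (coneDist T q₀)) :=
          (continuous_coneDist T).continuousAt
        refine tendsto_of_tendsto_of_tendsto_of_le_of_le' (by simpa using h2.sub h1)
          (by simpa using h2.add h1) ?_ ?_
        · filter_upwards [hev] with q hq
          have h3 : ‖q - R q‖ ≤ ‖q - q₀‖ + ‖q₀ - R q‖ := norm_sub_le_norm_sub_add_norm_sub ..
          rw [← hR q hq.1] at h3
          simp only [Function.comp_apply]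
          linarith
        · filter_upwards [hev] with q hq
          have h3 : ‖q₀ - R q‖ ≤ ‖q₀ - q‖ + ‖q - R q‖ := norm_sub_le_norm_sub_add_norm_sub ..
          rw [← hR q hq.1, norm_sub_rev q₀ q] at h3
          simp only [Function.comp_apply]
          linarith
      have hyd : ‖q₀ - y‖ = coneDist T q₀ :=
        eq_of_nhds_neBot (NeBot.mono hcl (inf_le_inf_left _ htend))
      rcases hyT with rfl | hyT
      · rw [sub_zero] at hyd
        exact absurd hyd (hT.coneDist_lt_norm hq0).ne'
      · exact hunique q₀ hqO y hyT (R q₀) (hRT q₀ hq0) hyd.symm (hR q₀ hq0)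

end Retraction

section Extension

open scoped Topology InnerProductSpace unitInterval
open Filter

attribute [local instance] InnerProductSpace.complexToReal

variable {E : Type*} [NormedAddCommGroup E] [InnerProductSpace ℂ E] [FiniteDimensional ℂ E]

/-- A function which is strictly subharmonic on the complex lines orthogonal to `q` has a positive
definite Hessian on a real subspace of large dimension. -/
theorem exists_submodule_hessian_pos {Φ : E → ℝ} {q : E} (hq : q ≠ 0) (hΦ : ContDiffAt ℝ 2 Φ q)
    (hpos : ∀ w, ⟪q, w⟫_ℂ = 0 → w ≠ 0 →
      0 < fderiv ℝ (fderiv ℝ Φ) q w w + fderiv ℝ (fderiv ℝ Φ) q (Complex.I • w) (Complex.I • w)) :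
    ∃ P : Submodule ℝ E, Module.finrank ℂ E ≤ Module.finrank ℝ P + 1 ∧
      ∀ e ∈ P, e ≠ 0 → 0 < fderiv ℝ (fderiv ℝ Φ) q e e := by
  let W : Submodule ℂ E := (ℂ ∙ q)ᗮ
  let ι : W →ₗ[ℝ] E := W.subtype.restrictScalars ℝ
  let B : W →ₗ[ℝ] W →ₗ[ℝ] ℝ := LinearMap.mk₂ ℝ (fun x y : W => fderiv ℝ (fderiv ℝ Φ) q (ι x) (ι y))
    (fun x y z => by simp) (fun c x y => by simp) (fun x y z => by simp) (fun c x y => by simp)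
  have hsymm : IsSymmSndFDerivAt ℝ Φ q := hΦ.isSymmSndFDerivAt (by simp)
  obtain ⟨P, hPd, hP⟩ := exists_posDef_subspace B (fun x y => hsymm.eq (ι x) (ι y)) fun w hw =>
    hpos w (Submodule.mem_orthogonal_singleton_iff_inner_right.1 w.2) (by simpa using hw)
  have hι : Function.Injective ι := W.injective_subtype
  refine ⟨P.map ι, ?_, ?_⟩
  · have h1 : Module.finrank ℝ (P.map ι) = Module.finrank ℝ P :=
      LinearEquiv.finrank_eq (P.equivMapOfInjective ι hι).symm
    have h2 := (ℂ ∙ q).finrank_add_finrank_orthogonal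
    rw [finrank_span_singleton hq] at h2
    rw [h1]
    change Module.finrank ℂ ((ℂ ∙ q)ᗮ : Submodule ℂ E) ≤ _ at hPd
    omega
  · rintro _ ⟨e, he, rfl⟩ he0
    exact hP e he fun h => he0 (by rw [h, map_zero])

/-- Maps from a closed subset of the square to `T` which extend to the ambient space extend to
maps to `T`. -/
theorem IsLeviFlatCone.exists_extension {T : Set E} (hT : IsLeviFlatCone T)
    (hdim : 4 ≤ Module.finrank ℂ E) {A : Set (I × I)} (hA : IsClosed A) {F : I × I → E}
    (hF : Continuous F) (hFA : ∀ k ∈ A, F k ∈ T) :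
    ∃ G : I × I → E, Continuous G ∧ (∀ k, G k ∈ T) ∧ EqOn G F A := by
  have : FiniteDimensional ℝ E := FiniteDimensional.complexToReal E
  obtain ⟨ε, hε, R, hRT, hRid, hRc⟩ := hT.exists_retraction
  set κ := ε / 6 with hκε
  have hκ : 0 < κ := by positivity
  obtain ⟨Φ, hΦ, hN, hnear, hfar, hon, hpos⟩ := hT.exists_potential hκ
  have hdimR : 3 ≤ Module.finrank ℝ E := by
    have := finrank_real_of_complex E
    omega
  obtain ⟨h, hh, h0, hhA⟩ := exists_eqOn_ne_zero hdimR hF hA fun k hk h0 =>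
    hT.zero_notMem (h0 ▸ hFA k hk)
  have hnorm0 : ∀ k, ‖h k‖ ≠ 0 := fun k => norm_ne_zero_iff.2 (h0 k)
  have hg : Continuous fun k => ‖h k‖⁻¹ • h k := (hh.norm.inv₀ hnorm0).smul hh
  have hg1 : ∀ k, ‖‖h k‖⁻¹ • h k‖ = 1 := fun k => norm_smul_inv_norm (𝕜 := ℝ) (h0 k)
  have hlog : -Real.log (5 * κ) < -Real.log (4 * κ) :=
    neg_lt_neg (Real.log_lt_log (by positivity) (by linarith))
  have hlog' : -Real.log (4 * κ) ≤ -Real.log (2 * κ) :=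
    neg_le_neg (Real.log_le_log (by positivity) (by linarith))
  obtain ⟨g, hgc, hgn, hgfix, hgΦ⟩ := exists_push hΦ hN hlog (fun q hq hlt => by
    have hq0 : q ≠ 0 := norm_ne_zero_iff.1 (by rw [hq]; exact one_ne_zero)
    have h3 : 3 * κ ≤ coneDist T q := by
      by_contra! hcon
      exact absurd (hnear q hq hcon.le) (not_le.2 hlt)
    obtain ⟨P, hPd, hP⟩ := exists_submodule_hessian_pos hq0 (hΦ q hq0) (hpos q hq h3)
    exact ⟨P, by omega, hP⟩) hg hg1
  have hgε : ∀ k, coneDist T (g k) < ε := fun k => by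
    by_contra! hcon
    exact absurd (hfar (g k) (hgn k) (by rw [hκε]; linarith)) (not_le.2 (hgΦ k))
  have hRg : Continuous fun k => R (g k) := continuous_iff_continuousAt.2 fun k =>
    ContinuousAt.comp (f := g) (hRc (g k) (hgn k) (hgε k)) hgc.continuousAt
  have hsmul : ∀ r : ℝ, r ≠ 0 → ∀ x ∈ T, r • x ∈ T := fun r hr x hx => by
    rw [← Complex.coe_smul]
    exact hT.smul_mem r (by exact_mod_cast hr) x hx
  refine ⟨fun k => ‖h k‖ • R (g k), hh.norm.smul hRg,
    fun k => hsmul _ (hnorm0 k) _ (hRT _ (hgn k)), fun k hk => ?_⟩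
  have h1 : ‖h k‖⁻¹ • h k ∈ T := hsmul _ (inv_ne_zero (hnorm0 k)) _ (by rw [hhA hk]; exact hFA k hk)
  have h2 : g k = ‖h k‖⁻¹ • h k := hgfix k (hlog'.trans (hon _ h1 (hg1 k)))
  simp only [h2]
  rw [hRid _ h1, smul_inv_smul₀ (hnorm0 k), hhA hk]

end Extension

section Covering

open scoped Topology InnerProductSpace unitInterval
open Filter

/-- A space covered by a cone `T` with one-dimensional fibres, with path lifting, is simply
connected as soon as maps from the square to the ambient space which are `T`-valued on a closed
subset can be deformed to `T` relative to this subset. -/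
theorem simplyConnectedSpace_of_extension {E X : Type*} [NormedAddCommGroup E] [NormedSpace ℂ E]
    [TopologicalSpace X] {T : Set E} (hT : T.Nonempty) {f : T → X} (hf : Continuous f)
    (hsurj : Function.Surjective f)
    (hsmul : ∀ c : ℂ, c ≠ 0 → ∀ v : T, ∃ h : c • (v : E) ∈ T, f ⟨_, h⟩ = f v)
    (hfib : ∀ v w : T, f v = f w → ∃ c : ℂ, c ≠ 0 ∧ c • (v : E) = w)
    (hlift : ∀ γ : C(I, X), ∀ v : T, f v = γ 0 →
      ∃ a : I → E, Continuous a ∧ a 0 = v ∧ ∀ t, ∃ h : a t ∈ T, f ⟨_, h⟩ = γ t)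
    (hext : ∀ (A : Set (I × I)) (F : I × I → E), IsClosed A → Continuous F → (∀ k ∈ A, F k ∈ T) →
      ∃ G : I × I → E, Continuous G ∧ (∀ k, G k ∈ T) ∧ EqOn G F A) :
    SimplyConnectedSpace X := by
  rw [simply_connected_iff_paths_homotopic']
  constructor
  · obtain ⟨v₀, hv₀⟩ := hT
    refine ⟨⟨f ⟨v₀, hv₀⟩⟩, fun x y => ?_⟩
    obtain ⟨v, rfl⟩ := hsurj x
    obtain ⟨w, rfl⟩ := hsurj y
    let F : I × I → E := fun k => (1 - (k.1 : ℝ) : ℂ) • (v : E) + ((k.1 : ℝ) : ℂ) • (w : E)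
    obtain ⟨G, hG, hGT, hGF⟩ := hext {k | k.1 = 0 ∨ k.1 = 1} F
      ((isClosed_eq continuous_fst continuous_const).union
        (isClosed_eq continuous_fst continuous_const)) (by fun_prop) (by
          rintro ⟨s, t⟩ (rfl | rfl)
          · simp [F]
          · simp [F])
    refine ⟨⟨⟨fun t => f ⟨G (t, 0), hGT _⟩, hf.comp (by fun_prop)⟩, ?_, ?_⟩⟩
    · change f ⟨G (0, 0), _⟩ = f v
      congr 1
      ext
      simp [hGF (show ((0, 0) : I × I) ∈ {k : I × I | k.1 = 0 ∨ k.1 = 1} from Or.inl rfl), F]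
    · change f ⟨G (1, 0), _⟩ = f w
      congr 1
      ext
      simp [hGF (show ((1, 0) : I × I) ∈ {k : I × I | k.1 = 0 ∨ k.1 = 1} from Or.inr rfl), F]
  · intro x y p₁ p₂
    obtain ⟨v, hv⟩ := hsurj x
    obtain ⟨a₁, ha₁, h0₁, hl₁⟩ := hlift p₁ v (by simpa using hv)
    obtain ⟨a₂, ha₂, h0₂, hl₂⟩ := hlift p₂ v (by simpa using hv)
    obtain ⟨hT₁, hf₁⟩ := hl₁ 1
    obtain ⟨hT₂, hf₂⟩ := hl₂ 1
    obtain ⟨c, hc, hcw⟩ := hfib ⟨_, hT₂⟩ ⟨_, hT₁⟩ (by rw [hf₁, hf₂]; simp)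
    let b : I → E := fun t => Complex.exp ((t : ℝ) * Complex.log c) • a₂ t
    have hb : Continuous b := by fun_prop
    have hbT : ∀ t, ∃ h : b t ∈ T, f ⟨_, h⟩ = p₂ t := fun t => by
      obtain ⟨h1, h2⟩ := hl₂ t
      obtain ⟨h3, h4⟩ := hsmul _ (Complex.exp_ne_zero ((t : ℝ) * Complex.log c)) ⟨_, h1⟩
      exact ⟨h3, h4.trans h2⟩
    have hb0 : b 0 = v := by simp [b, h0₂]
    have hb1 : b 1 = a₁ 1 := by simpa [b, Complex.exp_log hc] using hcw
    let F : I × I → E := fun k => (1 - (k.1 : ℝ) : ℂ) • a₁ k.2 + ((k.1 : ℝ) : ℂ) • b k.2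
    have hF0 : ∀ t, F (0, t) = a₁ t := fun t => by simp [F]
    have hF1 : ∀ t, F (1, t) = b t := fun t => by simp [F]
    have hF0' : ∀ s, F (s, 0) = v := fun s => by
      simp only [F, h0₁, hb0]
      rw [← add_smul, sub_add_cancel, one_smul]
    have hF1' : ∀ s, F (s, 1) = a₁ 1 := fun s => by
      simp only [F, hb1]
      rw [← add_smul, sub_add_cancel, one_smul]
    obtain ⟨G, hG, hGT, hGF⟩ := hext ({k | k.1 = 0 ∨ k.1 = 1} ∪ {k | k.2 = 0 ∨ k.2 = 1}) F
      (((isClosed_eq continuous_fst continuous_const).union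
        (isClosed_eq continuous_fst continuous_const)).union
        ((isClosed_eq continuous_snd continuous_const).union
        (isClosed_eq continuous_snd continuous_const))) (by fun_prop) (by
          rintro ⟨s, t⟩ ((h | h) | (h | h)) <;> obtain rfl := h
          · rw [hF0]
            exact (hl₁ t).1
          · rw [hF1]
            exact (hbT t).1
          · rw [hF0']
            exact v.2
          · rw [hF1']
            exact hT₁)
    have key : ∀ (u w : T), (u : E) = w → f u = f w := fun u w h => congrArg f (Subtype.ext h)
    refine ⟨⟨⟨⟨fun k => f ⟨G k, hGT k⟩, hf.comp (by fun_prop)⟩, fun t => ?_, fun t => ?_⟩,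
      fun s t ht => ?_⟩⟩
    · obtain ⟨h1, h2⟩ := hl₁ t
      exact (key _ ⟨_, h1⟩ ((hGF (Or.inl (Or.inl rfl))).trans (hF0 t))).trans h2
    · obtain ⟨h1, h2⟩ := hbT t
      exact (key _ ⟨_, h1⟩ ((hGF (Or.inl (Or.inr rfl))).trans (hF1 t))).trans h2
    · rcases ht with ht | ht <;> obtain rfl := ht
      · exact (key _ v ((hGF (Or.inr (Or.inl rfl))).trans (hF0' s))).trans (by simpa using hv)
      · exact (key _ ⟨_, hT₁⟩ ((hGF (Or.inr (Or.inr rfl))).trans (hF1' s))).trans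
          (by simpa using hf₁)

/-- A continuous family of projections along a path admits a nowhere vanishing section with
prescribed starting point. -/
theorem exists_section_of_projections {E : Type*} [NormedAddCommGroup E] [NormedSpace ℂ E]
    {P : I → E →L[ℂ] E} (hP : Continuous P) (hPP : ∀ t x, P t (P t x) = P t x) {v : E}
    (hv : v ≠ 0) (hPv : P 0 v = v) :
    ∃ a : I → E, Continuous a ∧ a 0 = v ∧ ∀ t, a t ≠ 0 ∧ P t (a t) = a t := by
  obtain ⟨δ, hδ, hδP⟩ := Metric.uniformContinuous_iff.1
    (CompactSpace.uniformContinuous_of_continuous hP) 1 one_pos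
  obtain ⟨N, hN⟩ := exists_nat_one_div_lt hδ
  have hN0 : (0 : ℝ) < N + 1 := by positivity
  let τ : ℕ → I → I := fun i t => min t (projIcc 0 1 zero_le_one (i / (N + 1)))
  have hτ : ∀ i, Continuous (τ i) := fun i => by fun_prop
  have hstep : ∀ i t, dist (τ (i + 1) t) (τ i t) < δ := fun i t => by
    refine lt_of_le_of_lt ?_ hN
    have h1 : |((i + 1 : ℕ) : ℝ) / (N + 1) - i / (N + 1)| = 1 / (N + 1) := by
      rw [← sub_div, Nat.cast_succ, add_sub_cancel_left, abs_of_pos (by positivity)]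
    rw [← h1, Subtype.dist_eq, Real.dist_eq]
    simp only [τ, (Subtype.mono_coe (· ∈ I)).map_min, coe_projIcc]
    refine (abs_min_sub_min_le_max _ _ _ _).trans ?_
    rw [sub_self, abs_zero, max_eq_right (abs_nonneg _)]
    refine (abs_max_sub_max_le_max _ _ _ _).trans ?_
    rw [sub_self, abs_zero, max_eq_right (abs_nonneg _)]
    refine (abs_min_sub_min_le_max _ _ _ _).trans ?_
    rw [sub_self, abs_zero, max_eq_right (abs_nonneg _)]
  have main : ∀ i : ℕ, ∃ a : I → E, Continuous a ∧ a 0 = v ∧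
      ∀ t, a t ≠ 0 ∧ P (τ i t) (a t) = a t := by
    intro i
    induction i with
    | zero =>
      refine ⟨fun _ => v, continuous_const, rfl, fun t => ⟨hv, ?_⟩⟩
      have : τ 0 t = 0 := by simp [τ]
      rw [this, hPv]
    | succ i ih =>
      obtain ⟨a, ha, ha0, haP⟩ := ih
      refine ⟨fun t => P (τ (i + 1) t) (a t), (hP.comp (hτ _)).clm_apply ha, ?_,
        fun t => ⟨fun (h0 : P (τ (i + 1) t) (a t) = 0) => ?_, hPP _ _⟩⟩
      · have : τ (i + 1) 0 = 0 := min_eq_left (by simp)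
        simp only [this, ha0, hPv]
      · have h1 := hδP (hstep i t)
        rw [dist_eq_norm] at h1
        have h2 := (P (τ (i + 1) t) - P (τ i t)).le_opNorm (a t)
        rw [sub_apply, h0, (haP t).2, zero_sub, norm_neg] at h2
        have h3 : 0 < ‖a t‖ := norm_pos_iff.2 (haP t).1
        nlinarith
  obtain ⟨a, ha, ha0, haP⟩ := main (N + 1)
  refine ⟨a, ha, ha0, fun t => ?_⟩
  have : τ (N + 1) t = t := by
    refine min_eq_left (Subtype.coe_le_coe.1 ?_)
    rw [coe_projIcc]
    have : (((N + 1 : ℕ) : ℝ) / (N + 1)) = 1 := by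
      push_cast
      exact div_self hN0.ne'
    rw [this]
    simpa using t.2.2
  have h := haP t
  rwa [this] at h

end Covering

section Transport

open scoped Topology InnerProductSpace unitInterval

attribute [local instance] InnerProductSpace.complexToReal

variable {E : Type*} [NormedAddCommGroup E] [InnerProductSpace ℂ E]

/-- Levi-flat cones can be transported along linear equivalences. -/
theorem IsLeviFlatCone.of_continuousLinearEquiv {F : Type*} [NormedAddCommGroup F] [NormedSpace ℂ F]
    [NormedSpace ℝ F] [IsScalarTower ℝ ℂ F] (L : E ≃L[ℂ] F) {S : Set F} (hne : S.Nonempty)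
    (h0 : (0 : F) ∉ S) (hsmul : ∀ c : ℂ, c ≠ 0 → ∀ m ∈ S, c • m ∈ S) (hcl : IsClosed (insert 0 S))
    (hdef : ∀ p ∈ S, ∃ (V : Set F) (ρ : F → ℝ), IsOpen V ∧ p ∈ V ∧ ContDiffOn ℝ 2 ρ V ∧
      (∀ q ∈ V, fderiv ℝ ρ q ≠ 0) ∧ (∀ q ∈ V, q ∈ S ↔ ρ q = 0) ∧
      ∀ w, fderiv ℝ ρ p w = 0 → fderiv ℝ ρ p (Complex.I • w) = 0 →
        iteratedFDeriv ℝ 2 ρ p ![w, w] +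
          iteratedFDeriv ℝ 2 ρ p ![Complex.I • w, Complex.I • w] = 0) :
    IsLeviFlatCone (L ⁻¹' S) where
  nonempty := hne.preimage L.surjective
  zero_notMem h := h0 (by simpa using h)
  smul_mem c hc m hm := by
    rw [mem_preimage, map_smul]
    exact hsmul c hc _ hm
  isClosed := by
    have : insert 0 (L ⁻¹' S) = L ⁻¹' (insert 0 S) := by
      ext x
      simp
    rw [this]
    exact hcl.preimage L.continuous
  exists_defining := by
    intro p hp
    obtain ⟨V, ρ, hV, hpV, hρ, hρ0, hmem, hlevi⟩ := hdef _ hp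
    let L' : E ≃L[ℝ] F :=
      { toLinearEquiv := L.toLinearEquiv.restrictScalars ℝ
        continuous_toFun := L.continuous
        continuous_invFun := L.symm.continuous }
    have hL' : ∀ x, L' x = L x := fun x => rfl
    have hd : ∀ x w, fderiv ℝ (ρ ∘ L') x w = fderiv ℝ ρ (L x) (L w) := fun x w => by
      rw [L'.comp_right_fderiv]
      rfl
    refine ⟨L ⁻¹' V, ρ ∘ L', hpV, ⟨hV.preimage L.continuous, ?_, fun q hq h => ?_,
      fun q hq => hmem _ hq⟩, fun w h1 h2 => ?_⟩
    · exact hρ.comp_continuousLinearMap (L' : E →L[ℝ] F)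
    · refine hρ0 _ hq ?_
      ext y
      have := hd q (L.symm y)
      rw [h, L.apply_symm_apply] at this
      exact this.symm
    · rw [hd] at h1 h2
      rw [map_smul] at h2
      have key : ∀ w, fderiv ℝ (fderiv ℝ (ρ ∘ L')) p w w =
          iteratedFDeriv ℝ 2 ρ (L p) ![L w, L w] := by
        intro w
        have h3 : HasFDerivAt (fderiv ℝ ρ) (fderiv ℝ (fderiv ℝ ρ) (L' p)) (L' p) :=
          (((hρ.contDiffAt (hV.mem_nhds hpV)).fderiv_right (m := 1) (by norm_num)).differentiableAt
            one_ne_zero).hasFDerivAt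
        have h4 := ((ContinuousLinearMap.compL ℝ E F ℝ).flip (L' : E →L[ℝ] F)).hasFDerivAt.comp p
          (h3.comp p L'.hasFDerivAt)
        have h5 : fderiv ℝ (ρ ∘ L') = ((ContinuousLinearMap.compL ℝ E F ℝ).flip (L' : E →L[ℝ] F)) ∘
            (fderiv ℝ ρ ∘ L') := funext fun x => L'.comp_right_fderiv
        rw [h5, h4.fderiv, iteratedFDeriv_two_apply]
        rfl
      rw [key, key, map_smul]
      exact hlevi _ h1 h2

/-- The orthogonal projection to the line spanned by `v`. -/
def lineProj (v : E) : E →L[ℂ] E := ((‖v‖ : ℂ) ^ 2)⁻¹ • (innerSL ℂ v).smulRight v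

theorem lineProj_apply (v x : E) : lineProj v x = (((‖v‖ : ℂ) ^ 2)⁻¹ * ⟪v, x⟫_ℂ) • v := by
  simp [lineProj, smul_smul]

theorem lineProj_smul_self {v : E} (hv : v ≠ 0) (c : ℂ) : lineProj v (c • v) = c • v := by
  rw [lineProj_apply, inner_smul_right, inner_self_eq_norm_sq_to_K]
  have : (‖v‖ : ℂ) ≠ 0 := by exact_mod_cast norm_ne_zero_iff.2 hv
  congr 1
  simp only [coe_algebraMap]
  field_simp

theorem lineProj_smul {c : ℂ} (hc : c ≠ 0) (v : E) : lineProj (c • v) = lineProj v := by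
  ext x
  rw [lineProj_apply, lineProj_apply, smul_smul, inner_smul_left, norm_smul]
  congr 1
  have h1 : (starRingEnd ℂ) c * c = (‖c‖ : ℂ) ^ 2 := by
    rw [mul_comm, Complex.mul_conj, Complex.normSq_eq_norm_sq]
    norm_cast
  have h2 : (‖c‖ : ℂ) ≠ 0 := by exact_mod_cast norm_ne_zero_iff.2 hc
  push_cast
  rw [mul_pow, mul_inv]
  calc _ = ((‖c‖ : ℂ) ^ 2)⁻¹ * ((starRingEnd ℂ) c * c) * (((‖v‖ : ℂ) ^ 2)⁻¹ * ⟪v, x⟫_ℂ) := by ring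
    _ = _ := by rw [h1, inv_mul_cancel₀ (pow_ne_zero 2 h2), one_mul]

theorem continuousAt_lineProj {v : E} (hv : v ≠ 0) : ContinuousAt (lineProj (E := E)) v := by
  have h1 : (‖v‖ : ℂ) ^ 2 ≠ 0 := pow_ne_zero 2 (by exact_mod_cast norm_ne_zero_iff.2 hv)
  have h2 : Continuous fun v : E => (innerSL ℂ v).smulRight v := by
    have := ContinuousLinearMap.smulRightL ℂ E E
    fun_prop
  have h3 : ContinuousAt (fun v : E => ((‖v‖ : ℂ) ^ 2)⁻¹) v := ContinuousAt.inv₀ (by fun_prop) h1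
  exact h3.smul h2.continuousAt

end Transport

section Projective

open scoped unitInterval

theorem isQuotientMap_projectivizationMk (n : ℕ) : Topology.IsQuotientMap
    fun v : {v : Fin n → ℂ // v ≠ 0} => Projectivization.mk ℂ v.1 v.2 :=
  isQuotientMap_quot_mk

theorem isClosed_insert_coneOver {n : ℕ} {M : Set (ℙ ℂ (Fin (n + 1) → ℂ))} (hM : IsClosed M) :
    IsClosed (insert 0 (coneOver M)) := by
  have h1 : IsOpen ((fun v : {v : Fin (n + 1) → ℂ // v ≠ 0} =>
      Projectivization.mk ℂ v.1 v.2) ⁻¹' Mᶜ) :=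
    hM.isOpen_compl.preimage (isQuotientMap_projectivizationMk (n + 1)).continuous
  have h2 := (isOpen_ne (x := (0 : Fin (n + 1) → ℂ))).isOpenMap_subtype_val _ h1
  rw [← isOpen_compl_iff]
  convert h2 using 1
  ext v
  simp only [coneOver, mem_compl_iff, mem_insert_iff, mem_ofPred_eq, not_or, not_exists, mem_image,
    mem_preimage, Subtype.exists, exists_and_right, exists_eq_right]
  exact ⟨fun h => ⟨h.1, h.2 h.1⟩, fun ⟨h, h'⟩ => ⟨h, fun _ => h'⟩⟩

theorem smul_mem_coneOver {n : ℕ} {M : Set (ℙ ℂ (Fin (n + 1) → ℂ))} {c : ℂ} (hc : c ≠ 0)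
    {v : Fin (n + 1) → ℂ} (hv : v ∈ coneOver M) : c • v ∈ coneOver M := by
  obtain ⟨h, hM⟩ := hv
  refine ⟨smul_ne_zero hc h, ?_⟩
  rwa [(Projectivization.mk_eq_mk_iff' ℂ _ _ (smul_ne_zero hc h) h).2 ⟨c, rfl⟩]

/-- The cone over a Levi-flat hypersurface, as a subset of a Euclidean space. -/
theorem IsSmoothLeviFlatHypersurface.isLeviFlatCone {n : ℕ} {M : Set (ℙ ℂ (Fin (n + 1) → ℂ))}
    (hne : M.Nonempty) (hcl : IsClosed M) (hLF : IsSmoothLeviFlatHypersurface (coneOver M)) :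
    IsLeviFlatCone (EuclideanSpace.equiv (Fin (n + 1)) ℂ ⁻¹' coneOver M) := by
  refine IsLeviFlatCone.of_continuousLinearEquiv _ ?_ (fun ⟨h, _⟩ => h rfl)
    (fun c hc m hm => smul_mem_coneOver hc hm) (isClosed_insert_coneOver hcl) fun p hp => ?_
  · obtain ⟨x, hx⟩ := hne
    exact ⟨x.rep, x.rep_nonzero, by rwa [x.mk_rep]⟩
  · obtain ⟨V, hV, hpV, ρ, hρ, hρ0, hmem, hlevi⟩ := hLF p hp
    exact ⟨V, ρ, hV, hpV, hρ 2, hρ0, hmem, fun w h1 h2 =>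
      hlevi p hpV ((hmem p hpV).1 hp) w ⟨h1, h2⟩⟩

/-- Orthogonal projections to lines depend continuously on the line. -/
theorem exists_continuous_lineProj {n : ℕ} {E : Type*} [NormedAddCommGroup E]
    [InnerProductSpace ℂ E] [FiniteDimensional ℂ E] (L : E ≃L[ℂ] (Fin n → ℂ)) :
    ∃ Q : ℙ ℂ (Fin n → ℂ) → E →L[ℂ] E, Continuous Q ∧
      ∀ v (hv : L v ≠ 0), Q (Projectivization.mk ℂ (L v) hv) = lineProj v := by
  let Q : ℙ ℂ (Fin n → ℂ) → E →L[ℂ] E := fun x => lineProj (L.symm x.rep)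
  have hQ : ∀ v (hv : v ≠ 0), Q (Projectivization.mk ℂ v hv) = lineProj (L.symm v) := by
    intro v hv
    obtain ⟨c, hc⟩ := Projectivization.exists_smul_eq_mk_rep ℂ v hv
    simp only [Q]
    rw [← hc, Units.smul_def, map_smul, lineProj_smul c.ne_zero]
  refine ⟨Q, (isQuotientMap_projectivizationMk n).continuous_iff.2 ?_, fun v hv => by
    rw [hQ, L.symm_apply_apply]⟩
  have : (Q ∘ fun v : {v : Fin n → ℂ // v ≠ 0} => Projectivization.mk ℂ v.1 v.2) =
      fun v => lineProj (L.symm v.1) := funext fun v => hQ v.1 v.2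
  rw [this]
  refine continuous_iff_continuousAt.2 fun v => ?_
  exact ContinuousAt.comp (f := fun v : {v : Fin n → ℂ // v ≠ 0} => L.symm v.1)
    (continuousAt_lineProj (by simpa using v.2)) (by fun_prop)

end Projective

/-- A closed smooth Levi-flat hypersurface in `ℂℙⁿ`, `n > 2`, is simply connected. -/
theorem leviFlat_in_CPn_simply_connected (n : ℕ) (hn : 2 < n)
    (M : Set (ℙ ℂ (Fin (n + 1) → ℂ))) (hne : M.Nonempty) (hcl : IsClosed M)
    (hLF : IsSmoothLeviFlatHypersurface (coneOver M)) :
    SimplyConnectedSpace M := by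
  have hT := hLF.isLeviFlatCone hne hcl
  let L : EuclideanSpace ℂ (Fin (n + 1)) ≃L[ℂ] (Fin (n + 1) → ℂ) :=
    EuclideanSpace.equiv (Fin (n + 1)) ℂ
  obtain ⟨Q, hQ, hQL⟩ := exists_continuous_lineProj L
  let f : L ⁻¹' coneOver M → M := fun v => ⟨Projectivization.mk ℂ (L v) v.2.1, v.2.2⟩
  have hf : Continuous f := ((isQuotientMap_projectivizationMk (n + 1)).continuous.comp
    (f := fun v : L ⁻¹' coneOver M => (⟨L v, v.2.1⟩ : {v : Fin (n + 1) → ℂ // v ≠ 0}))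
    (by fun_prop)).subtype_mk _
  refine simplyConnectedSpace_of_extension hT.nonempty hf ?_ ?_ ?_ ?_
    fun A F hA hF hFA => hT.exists_extension (by simp; omega) hA hF hFA
  · rintro ⟨x, hx⟩
    refine ⟨⟨L.symm x.rep, ?_⟩, ?_⟩
    · rw [mem_preimage, L.apply_symm_apply]
      exact ⟨x.rep_nonzero, by rwa [x.mk_rep]⟩
    · ext1
      simp [f, x.mk_rep]
  · intro c hc v
    refine ⟨hT.smul_mem c hc _ v.2, ?_⟩
    ext1
    exact (Projectivization.mk_eq_mk_iff' ℂ _ _ _ _).2 ⟨c, (map_smul L c v.1).symm⟩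
  · intro v w h
    obtain ⟨c, hc⟩ := (Projectivization.mk_eq_mk_iff ℂ _ _ _ _).1 (congrArg Subtype.val h).symm
    refine ⟨c, c.ne_zero, L.injective ?_⟩
    rw [map_smul]
    exact hc
  · intro γ v hv
    have hγ : ∀ t, ∃ w : EuclideanSpace ℂ (Fin (n + 1)), ∃ h : L w ≠ 0,
        Projectivization.mk ℂ (L w) h = γ t := fun t =>
      ⟨L.symm (γ t).1.rep, by simpa using (γ t).1.rep_nonzero, by simp [(γ t).1.mk_rep]⟩
    have hLne : ∀ w, L w ≠ 0 → w ≠ 0 := fun w h h0 => h (by rw [h0, map_zero])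
    have hv0 : (v : EuclideanSpace ℂ (Fin (n + 1))) ≠ 0 := hLne _ v.2.1
    obtain ⟨a, ha, ha0, haP⟩ := exists_section_of_projections (P := fun t => Q (γ t))
      (hQ.comp (by fun_prop)) (fun t x => by
        obtain ⟨w, hw, hwγ⟩ := hγ t
        simp only [← hwγ, hQL]
        rw [lineProj_apply w x, lineProj_smul_self (hLne w hw)]) hv0 (by
        rw [← hv]
        simp only [f]
        rw [hQL]
        simpa using lineProj_smul_self hv0 1)
    refine ⟨a, ha, ha0, fun t => ?_⟩
    obtain ⟨w, hw, hwγ⟩ := hγ t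
    obtain ⟨hat, hPa⟩ := haP t
    have hLa : L (a t) ≠ 0 := by simpa using hat
    have hmk : Projectivization.mk ℂ (L (a t)) hLa = γ t := by
      rw [← hwγ, hQL, lineProj_apply] at hPa
      rw [← hwγ]
      exact (Projectivization.mk_eq_mk_iff' ℂ _ _ _ _).2 ⟨_, by rw [← map_smul, hPa]⟩
    exact ⟨⟨hLa, by rw [hmk]; exact (γ t).2⟩, Subtype.ext hmk⟩
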